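/- There exist positive constants τ₀, s₀, ρ, C and a choice of β (with α₊, α₋ chosen so that L < α₊/α₋), all depending only on λ₀ and M₀, such that for every τ ≥ τ₀, every 0 < s ≤ s₀ < 1, every ξ ∈ ℝ^{n−1}, and all smooth v̂±(ξ,·) with supp v̂±(ξ,·) ⊂ [−ρ, ρ], one has (1/τ) Σ± ‖∂_y² v̂±(ξ,·)‖²_{L²(ℝ±)} + (Λ²/τ) Σ± ‖∂_y v̂±(ξ,·)‖²_{L²(ℝ±)} + (Λ⁴/τ) Σ± ‖v̂±(ξ,·)‖²_{L²(ℝ±)} + Λ Σ± |V±(ξ)|² + Λ³ Σ± |v̂±(ξ,0)|² ≤ C ( Σ± ‖P± v̂±(ξ,·)‖²_{L²(ℝ±)} + Λ |η₁(ξ)|² + Λ³ |η₀(ξ)|² ). -/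

import Mathlib

open MeasureTheory

noncomputable section

/-- `ℝ^m`, the tangential space (here `m = n - 1`). -/
abbrev Em (m : ℕ) : Type := EuclideanSpace ℝ (Fin m)

variable {m : ℕ}

/-- The entry `a_{nn}(y)` of the coefficient matrix. -/
def ann (a : ℝ → Matrix (Fin (m + 1)) (Fin (m + 1)) ℝ) (y : ℝ) : ℝ :=
  a y (Fin.last m) (Fin.last m)

/-- `b_{jk}(y) = a_{jk}(y) - a_{nj}(y) a_{nk}(y) / a_{nn}(y)`. -/
def bcoef (a : ℝ → Matrix (Fin (m + 1)) (Fin (m + 1)) ℝ) (j k : Fin m) (y : ℝ) : ℝ :=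
  a y j.castSucc k.castSucc -
    a y (Fin.last m) j.castSucc * a y (Fin.last m) k.castSucc / ann a y

/-- The quadratic form `B(ξ, η, y) = Σ_{jk} b_{jk}(y) ξ_j η_k`. -/
def Bform (a : ℝ → Matrix (Fin (m + 1)) (Fin (m + 1)) ℝ) (ξ η : Em m) (y : ℝ) : ℝ :=
  ∑ j, ∑ k, bcoef a j k y * ξ j * η k

/-- `t(ξ, y) = Σ_j a_{nj}(y) ξ_j / a_{nn}(y)`. -/
def tform (a : ℝ → Matrix (Fin (m + 1)) (Fin (m + 1)) ℝ) (ξ : Em m) (y : ℝ) : ℝ :=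
  (∑ j, a y (Fin.last m) j.castSucc * ξ j) / ann a y

/-- `m(ξ, y) = (B(ξ,ξ,y)/a_{nn}(y))^{1/2}`. -/
def mfun (a : ℝ → Matrix (Fin (m + 1)) (Fin (m + 1)) ℝ) (ξ : Em m) (y : ℝ) : ℝ :=
  Real.sqrt (Bform a ξ ξ y / ann a y)

/-- `t(ξ + iτsγ, y)`, the ℂ-linear extension of `t` evaluated at `ξ + iτsγ`. -/
def tC (a : ℝ → Matrix (Fin (m + 1)) (Fin (m + 1)) ℝ) (ξ γ : Em m) (τ s y : ℝ) : ℂ :=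
  (tform a ξ y : ℂ) + Complex.I * ((τ * s : ℝ) : ℂ) * (tform a γ y : ℂ)

/-- `ζ(ξ,y) = a_{nn}(y)⁻¹ [B(ξ,ξ,y) + 2isτ B(ξ,γ,y) - s²τ² B(γ,γ,y)]`. -/
def zetafun (a : ℝ → Matrix (Fin (m + 1)) (Fin (m + 1)) ℝ) (ξ γ : Em m) (τ s y : ℝ) : ℂ :=
  ((ann a y : ℝ) : ℂ)⁻¹ *
    ((Bform a ξ ξ y : ℂ) + 2 * Complex.I * ((s * τ : ℝ) : ℂ) * (Bform a ξ γ y : ℂ) -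
      ((s * τ : ℝ) : ℂ) ^ 2 * (Bform a γ γ y : ℂ))

/-- The principal square root `√ζ`. -/
def sqz (a : ℝ → Matrix (Fin (m + 1)) (Fin (m + 1)) ℝ) (ξ γ : Em m) (τ s y : ℝ) : ℂ :=
  zetafun a ξ γ τ s y ^ ((1 : ℂ) / 2)

/-- The first-order factor `E v = ∂_y v + i t(ξ+iτsγ,y) v - (τφ' + √ζ) v`. -/
def Eop (a : ℝ → Matrix (Fin (m + 1)) (Fin (m + 1)) ℝ) (ξ γ : Em m) (τ s α β : ℝ)
    (v : ℝ → ℂ) (y : ℝ) : ℂ :=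
  deriv v y +
    (Complex.I * tC a ξ γ τ s y - (((τ * (α + β * y) : ℝ) : ℂ) + sqz a ξ γ τ s y)) * v y

/-- The first-order factor `F v = ∂_y v + i t(ξ+iτsγ,y) v - (τφ' - √ζ) v`. -/
def Fop (a : ℝ → Matrix (Fin (m + 1)) (Fin (m + 1)) ℝ) (ξ γ : Em m) (τ s α β : ℝ)
    (v : ℝ → ℂ) (y : ℝ) : ℂ :=
  deriv v y +
    (Complex.I * tC a ξ γ τ s y - (((τ * (α + β * y) : ℝ) : ℂ) - sqz a ξ γ τ s y)) * v y

/-- `a_{nn}(y) (∂_y - τφ' + i t(ξ+iτsγ,y)) v`. -/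
def Pinner (a : ℝ → Matrix (Fin (m + 1)) (Fin (m + 1)) ℝ) (ξ γ : Em m) (τ s α β : ℝ)
    (v : ℝ → ℂ) (y : ℝ) : ℂ :=
  (ann a y : ℂ) * (deriv v y + (Complex.I * tC a ξ γ τ s y - ((τ * (α + β * y) : ℝ) : ℂ)) * v y)

/-- The conjugated operator
`P v = (∂_y - τφ' + i t(ξ+iτsγ,y)) [a_{nn} (∂_y - τφ' + i t(ξ+iτsγ,y)) v] - a_{nn} ζ v`. -/
def Pop (a : ℝ → Matrix (Fin (m + 1)) (Fin (m + 1)) ℝ) (ξ γ : Em m) (τ s α β : ℝ)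
    (v : ℝ → ℂ) (y : ℝ) : ℂ :=
  deriv (Pinner a ξ γ τ s α β v) y +
    (Complex.I * tC a ξ γ τ s y - ((τ * (α + β * y) : ℝ) : ℂ)) * Pinner a ξ γ τ s α β v y -
    (ann a y : ℂ) * zetafun a ξ γ τ s y * v y

/-- `V(ξ) = a_{nn}(0) [∂_y v(0) - τα v(0) + i t(ξ+iτsγ,0) v(0)]`. -/
def Vval (a : ℝ → Matrix (Fin (m + 1)) (Fin (m + 1)) ℝ) (ξ γ : Em m) (τ s α : ℝ)
    (v : ℝ → ℂ) : ℂ :=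
  (ann a 0 : ℂ) * (deriv v 0 - ((τ * α : ℝ) : ℂ) * v 0 + Complex.I * tC a ξ γ τ s 0 * v 0)

/-- `ω₊ = a_{nn} F v`. -/
def omegaP (a : ℝ → Matrix (Fin (m + 1)) (Fin (m + 1)) ℝ) (ξ γ : Em m) (τ s α β : ℝ)
    (v : ℝ → ℂ) (y : ℝ) : ℂ :=
  (ann a y : ℂ) * Fop a ξ γ τ s α β v y

/-- `ω₋ = a_{nn} E v`. -/
def omegaM (a : ℝ → Matrix (Fin (m + 1)) (Fin (m + 1)) ℝ) (ξ γ : Em m) (τ s α β : ℝ)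
    (v : ℝ → ℂ) (y : ℝ) : ℂ :=
  (ann a y : ℂ) * Eop a ξ γ τ s α β v y

/-- Squared `L²` norm on `(0, ∞)`. -/
def L2p (v : ℝ → ℂ) : ℝ := ∫ y in Set.Ioi (0 : ℝ), ‖v y‖ ^ 2

/-- Squared `L²` norm on `(-∞, 0)`. -/
def L2m (v : ℝ → ℂ) : ℝ := ∫ y in Set.Iio (0 : ℝ), ‖v y‖ ^ 2

/-- `Λ = (|ξ|² + τ²)^{1/2}`. -/
def Lam (ξ : Em m) (τ : ℝ) : ℝ := Real.sqrt (‖ξ‖ ^ 2 + τ ^ 2)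

/-- `L = sup_{ξ ≠ 0} m₊(ξ,0)/m₋(ξ,0)`. -/
def Lconst (ap am : ℝ → Matrix (Fin (m + 1)) (Fin (m + 1)) ℝ) : ℝ :=
  ⨆ ξ : {ξ : Em m // ξ ≠ 0}, mfun ap ξ.1 0 / mfun am ξ.1 0

/-- `κ = (1 - L α₋/α₊)/2`. -/
def kappa (ap am : ℝ → Matrix (Fin (m + 1)) (Fin (m + 1)) ℝ) (αp αm : ℝ) : ℝ :=
  (1 - Lconst ap am * (αm / αp)) / 2

/-- The coefficient matrix `A(y)` is symmetric, uniformly elliptic with constant `λ₀`,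
and Lipschitz with constant `M₀`. -/
def GoodCoeff (lam0 M0 : ℝ) (a : ℝ → Matrix (Fin (m + 1)) (Fin (m + 1)) ℝ) : Prop :=
  (∀ y, (a y).IsSymm) ∧
  (∀ (y : ℝ) (z : EuclideanSpace ℝ (Fin (m + 1))),
      lam0 * ‖z‖ ^ 2 ≤ ∑ i, ∑ j, a y i j * z i * z j ∧
      ∑ i, ∑ j, a y i j * z i * z j ≤ lam0⁻¹ * ‖z‖ ^ 2) ∧
  (∀ y y' i j, |a y i j - a y' i j| ≤ M0 * |y - y'|)

/-- The ellipticity bounds `λ₁|ξ|² ≤ B(ξ,ξ,y) ≤ λ₁⁻¹|ξ|²`. -/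
def GoodB (lam1 : ℝ) (a : ℝ → Matrix (Fin (m + 1)) (Fin (m + 1)) ℝ) : Prop :=
  ∀ (ξ : Em m) (y : ℝ), lam1 * ‖ξ‖ ^ 2 ≤ Bform a ξ ξ y ∧ Bform a ξ ξ y ≤ lam1⁻¹ * ‖ξ‖ ^ 2

/-- Post-composition with a Lipschitz map preserves absolute continuity. -/
theorem AbsolutelyContinuousOnInterval.lipschitz_comp {X Y : Type*} [PseudoMetricSpace X]
    [PseudoMetricSpace Y] {f : ℝ → X} {φ : X → Y} {a b : ℝ}
    (hf : AbsolutelyContinuousOnInterval f a b) (hφ : ∀ x x', dist (φ x) (φ x') ≤ dist x x') :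
    AbsolutelyContinuousOnInterval (fun y => φ (f y)) a b := by
  rw [absolutelyContinuousOnInterval_iff] at hf ⊢
  intro ε hε
  obtain ⟨δ, hδ, h⟩ := hf ε hε
  refine ⟨δ, hδ, fun E hE hlt => lt_of_le_of_lt ?_ (h E hE hlt)⟩
  exact Finset.sum_le_sum fun i _ => hφ _ _

theorem AbsolutelyContinuousOnInterval.norm_sq {w : ℝ → ℂ} {a b : ℝ}
    (hw : AbsolutelyContinuousOnInterval w a b) :
    AbsolutelyContinuousOnInterval (fun y => ‖w y‖ ^ 2) a b := by
  have hn : AbsolutelyContinuousOnInterval (fun y => ‖w y‖) a b :=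
    hw.lipschitz_comp (φ := fun z : ℂ => ‖z‖) fun x x' => by
      rw [Real.dist_eq, dist_eq_norm]; exact abs_norm_sub_norm_le x x'
  have := hn.mul hn
  have h2 : (fun y => ‖w y‖ ^ 2) = (fun y => ‖w y‖) * (fun y => ‖w y‖) := by
    ext y; simp [sq]
  rw [h2]; exact this

theorem hasDerivAt_norm_sq_complex {w : ℝ → ℂ} {w' : ℂ} {y : ℝ} (h : HasDerivAt w w' y) :
    HasDerivAt (fun y => ‖w y‖ ^ 2) (2 * ((w' * star (w y)).re)) y := by
  have := h.norm_sq
  convert this using 2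
  simp [Complex.inner]

/-- The basic weighted energy inequality for `w' = (κ + iθ) w + g`, obtained by integrating
`(κ |w|²)'` by parts. -/
theorem weighted_energy {a b μ : ℝ} (hab : a ≤ b) {w : ℝ → ℂ} {κ G : ℝ → ℝ}
    (hw : AbsolutelyContinuousOnInterval w a b) (hκ : AbsolutelyContinuousOnInterval κ a b)
    (hG : IntervalIntegrable G volume a b)
    (h : ∀ᵐ y, y ∈ Set.Ioo a b → ∃ (k' θ : ℝ) (g : ℂ),
      HasDerivAt w (((κ y : ℂ) + θ * Complex.I) * w y + g) y ∧ HasDerivAt κ k' y ∧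
      μ ≤ κ y ^ 2 + k' ∧ ‖g‖ ^ 2 ≤ G y) :
    μ * (∫ y in a..b, ‖w y‖ ^ 2) + κ a * ‖w a‖ ^ 2 ≤
      (∫ y in a..b, G y) + κ b * ‖w b‖ ^ 2 := by
  have hac := hκ.mul hw.norm_sq
  have hftc := hac.integral_deriv_eq_sub
  have hInt := hac.intervalIntegrable_deriv
  have hws : IntervalIntegrable (fun y => ‖w y‖ ^ 2) volume a b :=
    hw.norm_sq.continuousOn.intervalIntegrable
  have hmono : ∫ y in a..b, (μ * ‖w y‖ ^ 2 - G y) ≤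
      ∫ y in a..b, deriv (κ * fun y => ‖w y‖ ^ 2) y := by
    refine intervalIntegral.integral_mono_ae_restrict hab ((hws.const_mul μ).sub hG) hInt ?_
    rw [Filter.EventuallyLE, ae_restrict_iff' measurableSet_Icc]
    have hne : ∀ᵐ y : ℝ, y ≠ a ∧ y ≠ b := by
      have h1 : ∀ᵐ y : ℝ, y ≠ a := by simp [ae_iff]
      have h2 : ∀ᵐ y : ℝ, y ≠ b := by simp [ae_iff]
      exact h1.and h2
    filter_upwards [h, hne] with y hy hn hmem
    obtain ⟨k', θ, g, hwd, hκd, hμ, hg⟩ :=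
      hy ⟨lt_of_le_of_ne hmem.1 (Ne.symm hn.1), lt_of_le_of_ne hmem.2 hn.2⟩
    have hd := (hκd.mul (hasDerivAt_norm_sq_complex hwd)).deriv
    rw [hd]
    have hnw : ‖w y‖ ^ 2 = (w y).re ^ 2 + (w y).im ^ 2 := by
      rw [Complex.sq_norm, Complex.normSq_apply]; ring
    have hng : ‖g‖ ^ 2 = g.re ^ 2 + g.im ^ 2 := by
      rw [Complex.sq_norm, Complex.normSq_apply]; ring
    have hN : 0 ≤ ‖w y‖ ^ 2 := by positivity
    have key := mul_le_mul_of_nonneg_right hμ hN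
    simp only [Complex.mul_re, Complex.add_re, Complex.add_im, Complex.mul_im, Complex.ofReal_re,
      Complex.ofReal_im, Complex.I_re, Complex.I_im, Complex.star_def, Complex.conj_re,
      Complex.conj_im] at *
    rw [hnw] at *
    rw [hng] at hg
    nlinarith [sq_nonneg (κ y * (w y).re + g.re), sq_nonneg (κ y * (w y).im + g.im)]
  rw [hftc, intervalIntegral.integral_sub (hws.const_mul μ) hG,
    intervalIntegral.integral_const_mul] at hmono
  simp only [Pi.mul_apply] at hmono
  linarith

/-- The first-order system `v' = (τψ - iT) v + u / A`, `u' = (τψ - iT) u + Z v + f` on `[a, b]`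
together with quantitative bounds on its coefficients. -/
structure FluxSystem (K Λ τ β lo hi a b : ℝ) (A T ψ : ℝ → ℝ) (Z v u f : ℝ → ℂ) : Prop where
  le : a ≤ b
  one_le_K : 1 ≤ K
  one_le_tau : 1 ≤ τ
  tau_le : τ ≤ Λ
  K_le_beta : K ≤ β
  one_le_lo : 1 ≤ lo
  lo_le : ∀ y ∈ Set.Icc a b, lo ≤ ψ y
  le_hi : ∀ y ∈ Set.Icc a b, ψ y ≤ hi
  A_pos : ∀ y, 0 < A y
  inv_le : ∀ y, (A y)⁻¹ ≤ K
  Z_le : ∀ y, ‖Z y‖ ≤ K * Λ ^ 2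
  ac_psi : AbsolutelyContinuousOnInterval ψ a b
  ac_v : AbsolutelyContinuousOnInterval v a b
  ac_u : AbsolutelyContinuousOnInterval u a b
  int_f : IntervalIntegrable (fun y => ‖f y‖ ^ 2) volume a b
  deriv_v : ∀ y, HasDerivAt v (((τ * ψ y : ℝ) - T y * Complex.I) * v y + u y / A y) y
  deriv_u : ∀ᵐ y, y ∈ Set.Ioo a b →
    HasDerivAt u (((τ * ψ y : ℝ) - T y * Complex.I) * u y + Z y * v y + f y) y
  deriv_psi : ∀ᵐ y, y ∈ Set.Ioo a b → ∃ d, HasDerivAt ψ d y ∧ β - K ≤ d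

namespace FluxSystem

variable {K Λ τ β lo hi a b : ℝ} {A T ψ : ℝ → ℝ} {Z v u f : ℝ → ℂ}

/-- Energy estimate when `τψ` dominates the coupling. -/
theorem energy_of_dominant (S : FluxSystem K Λ τ β lo hi a b A T ψ Z v u f)
    (hdom : 4 * K ^ 2 * Λ ^ 2 ≤ lo ^ 2 * τ ^ 2) :
    2 * K ^ 2 * Λ ^ 2 * (Λ ^ 2 * (∫ y in a..b, ‖v y‖ ^ 2) + ∫ y in a..b, ‖u y‖ ^ 2) +
        τ * ψ a * (Λ ^ 2 * ‖v a‖ ^ 2 + ‖u a‖ ^ 2) ≤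
      2 * (∫ y in a..b, ‖f y‖ ^ 2) + τ * ψ b * (Λ ^ 2 * ‖v b‖ ^ 2 + ‖u b‖ ^ 2) := by
  have hK := S.one_le_K
  have hτ := S.one_le_tau
  have hiv : IntervalIntegrable (fun y => ‖v y‖ ^ 2) volume a b :=
    S.ac_v.norm_sq.continuousOn.intervalIntegrable
  have hiu : IntervalIntegrable (fun y => ‖u y‖ ^ 2) volume a b :=
    S.ac_u.norm_sq.continuousOn.intervalIntegrable
  have hacψ : AbsolutelyContinuousOnInterval (fun y => τ * ψ y) a b := S.ac_psi.const_mul τ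
  have hμ : ∀ y ∈ Set.Ioo a b, ∀ d, β - K ≤ d → τ ^ 2 * lo ^ 2 ≤ (τ * ψ y) ^ 2 + τ * d := by
    intro y hy d hd
    have h1 := S.lo_le y (Set.Ioo_subset_Icc_self hy)
    have h2 : 0 ≤ d := by linarith [S.K_le_beta]
    have h3 := S.one_le_lo
    have h4 : lo ^ 2 ≤ ψ y ^ 2 := by nlinarith
    have h5 : 0 ≤ τ * d := by positivity
    have h6 := mul_le_mul_of_nonneg_left h4 (sq_nonneg τ)
    nlinarith
  have e1 := weighted_energy (μ := τ ^ 2 * lo ^ 2) (G := fun y => K ^ 2 * ‖u y‖ ^ 2) S.le S.ac_v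
    hacψ (hiu.const_mul _) (by
      filter_upwards [S.deriv_psi] with y hd hy
      obtain ⟨d, hd, hd'⟩ := hd hy
      refine ⟨τ * d, -T y, u y / A y, ?_, hd.const_mul τ, hμ y hy d hd', ?_⟩
      · convert S.deriv_v y using 1
        push_cast; ring
      · rw [norm_div, Complex.norm_real, Real.norm_of_nonneg (S.A_pos y).le, div_eq_mul_inv,
          mul_pow, mul_comm]
        have := S.inv_le y
        have h0 : 0 ≤ (A y)⁻¹ := (inv_pos.mpr (S.A_pos y)).le
        gcongr)
  have e2 := weighted_energy (μ := τ ^ 2 * lo ^ 2)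
    (G := fun y => 2 * K ^ 2 * Λ ^ 4 * ‖v y‖ ^ 2 + 2 * ‖f y‖ ^ 2) S.le S.ac_u
    hacψ ((hiv.const_mul _).add (S.int_f.const_mul _)) (by
      filter_upwards [S.deriv_psi, S.deriv_u] with y hd hu hy
      obtain ⟨d, hd, hd'⟩ := hd hy
      refine ⟨τ * d, -T y, Z y * v y + f y, ?_, hd.const_mul τ, hμ y hy d hd', ?_⟩
      · convert hu hy using 1
        push_cast; ring
      · have h1 : ‖Z y * v y + f y‖ ≤ K * Λ ^ 2 * ‖v y‖ + ‖f y‖ := by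
          refine (norm_add_le _ _).trans ?_
          rw [norm_mul]
          gcongr
          exact S.Z_le y
        have h2 : ‖Z y * v y + f y‖ ^ 2 ≤ (K * Λ ^ 2 * ‖v y‖ + ‖f y‖) ^ 2 := by gcongr
        nlinarith [sq_nonneg (K * Λ ^ 2 * ‖v y‖ - ‖f y‖)])
  rw [intervalIntegral.integral_const_mul] at e1
  rw [intervalIntegral.integral_add (hiv.const_mul _) (S.int_f.const_mul _),
    intervalIntegral.integral_const_mul, intervalIntegral.integral_const_mul] at e2
  have e1' := mul_le_mul_of_nonneg_left e1 (sq_nonneg Λ)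
  have hIv : 0 ≤ ∫ y in a..b, ‖v y‖ ^ 2 :=
    intervalIntegral.integral_nonneg S.le fun y _ => by positivity
  have hIu : 0 ≤ ∫ y in a..b, ‖u y‖ ^ 2 :=
    intervalIntegral.integral_nonneg S.le fun y _ => by positivity
  set Iv := ∫ y in a..b, ‖v y‖ ^ 2
  set Iu := ∫ y in a..b, ‖u y‖ ^ 2
  have q1 := mul_le_mul_of_nonneg_right hdom (mul_nonneg (sq_nonneg Λ) hIv)
  have q2 := mul_le_mul_of_nonneg_right hdom hIu
  have q3 : 0 ≤ K ^ 2 * Λ ^ 2 * Iu := by positivity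
  linarith

end FluxSystem

/-- Data for diagonalising the system by `u ± p v`, where `p² = A Z`. -/
structure FluxRoot (K Λ a b : ℝ) (A : ℝ → ℝ) (Z p : ℝ → ℂ) : Prop where
  sq_eq : ∀ y, p y ^ 2 = A y * Z y
  norm_le : ∀ y, ‖p y‖ ≤ K * Λ
  le_norm : ∀ y, Λ / K ≤ (p y).re
  le_re : ∀ y, Λ / K ≤ (p y).re / A y
  re_le : ∀ y, (p y).re / A y ≤ K * Λ
  ac : AbsolutelyContinuousOnInterval p a b
  ac_re : AbsolutelyContinuousOnInterval (fun y => (p y).re / A y) a b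
  deriv : ∀ᵐ y, ∃ d, HasDerivAt p d y ∧ ‖d‖ ≤ K * Λ
  deriv_re : ∀ᵐ y, ∃ d, HasDerivAt (fun y => (p y).re / A y) d y ∧ |d| ≤ K * Λ

namespace FluxSystem

variable {K Λ τ β lo hi a b : ℝ} {A T ψ : ℝ → ℝ} {Z v u f p : ℝ → ℂ}

theorem ac_mul_add (S : FluxSystem K Λ τ β lo hi a b A T ψ Z v u f)
    (R : FluxRoot K Λ a b A Z p) (σ : ℝ) :
    AbsolutelyContinuousOnInterval (fun y => u y + σ * p y * v y) a b := by
  have h := S.ac_u.add ((R.ac.smul S.ac_v).const_smul (σ : ℂ))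
  have he : (fun y => u y + σ * p y * v y) = u + fun y => (σ : ℂ) • (p • v) y :=
    funext fun y => by simp [mul_assoc]
  rw [he]
  exact h

/-- The subelliptic lower bound for the two weights `τψ + σ Re(p)/A`, `σ = ±1`. -/
theorem weight_lower_bound {κ ψy r d d' : ℝ} {σ : ℝ} (hσ : σ = 1 ∨ σ = -1)
    (hK : 1 ≤ K) (hτ : 8 * K ^ 3 ≤ τ) (hτΛ : τ ≤ Λ) (hhi : 1 ≤ hi)
    (hβ : K + 4 * hi * K ^ 2 + 1 ≤ β) (hψ0 : 0 ≤ ψy) (hψ : ψy ≤ hi)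
    (hr : Λ / K ≤ r) (hd : β - K ≤ d) (hd' : |d'| ≤ K * Λ) (hκ : κ = τ * ψy + σ * r) :
    Λ ^ 2 / ((4 * hi * K) ^ 2 * τ) ≤ κ ^ 2 + (τ * d + σ * d') := by
  have hτ1 : 1 ≤ τ := by nlinarith [one_le_pow₀ hK (n := 3)]
  have hΛ : 0 < Λ := by linarith
  have hK0 : 0 < K := by linarith
  have hsd : -(K * Λ) ≤ σ * d' := by
    rcases hσ with rfl | rfl <;> nlinarith [abs_le.mp hd']
  have hr2 : 0 < 4 * hi * K := by positivity
  by_cases hc : Λ ≤ 4 * hi * K * τ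
  · have h1 : Λ ^ 2 / ((4 * hi * K) ^ 2 * τ) ≤ τ := by
      rw [div_le_iff₀ (by positivity)]
      have : Λ ^ 2 ≤ (4 * hi * K * τ) ^ 2 := by gcongr
      nlinarith
    have h2 : τ * (4 * hi * K ^ 2 + 1) ≤ τ * d := by
      apply mul_le_mul_of_nonneg_left _ (by linarith)
      linarith
    have h3 : K * Λ ≤ K * (4 * hi * K * τ) := by gcongr
    nlinarith [sq_nonneg κ]
  · push Not at hc
    have hrs : Λ / (2 * K) ≤ |κ| := by
      have h5 : τ * ψy ≤ Λ / (4 * K) := by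
        rw [le_div_iff₀ (by positivity)]
        have : τ * ψy ≤ τ * hi := by gcongr
        nlinarith
      have h6 : Λ / (4 * K) = Λ / K / 4 := by field_simp
      have h7 : Λ / (2 * K) = Λ / K / 2 := by field_simp
      have h8 : 0 < Λ / K := by positivity
      have h9 : 0 ≤ τ * ψy := by positivity
      rcases hσ with rfl | rfl
      · rw [le_abs]; left; rw [hκ]; linarith
      · rw [le_abs]; right; rw [hκ]; linarith
    have h1 : (Λ / (2 * K)) ^ 2 ≤ κ ^ 2 := by
      rw [← sq_abs κ]; gcongr
    have h2 : 0 ≤ τ * d := by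
      apply mul_nonneg (by linarith)
      nlinarith [sq_nonneg K]
    have h3 : Λ ^ 2 / ((4 * hi * K) ^ 2 * τ) ≤ Λ ^ 2 / (8 * K ^ 2) := by
      apply div_le_div_of_nonneg_left (by positivity) (by positivity)
      have : 1 ≤ hi ^ 2 * τ := by nlinarith [one_le_pow₀ hhi (n := 2)]
      nlinarith [sq_nonneg K, mul_le_mul_of_nonneg_left this (sq_nonneg K)]
    have h4 : K * Λ ≤ Λ ^ 2 / (8 * K ^ 2) := by
      rw [le_div_iff₀ (by positivity)]
      nlinarith
    have h5 : (Λ / (2 * K)) ^ 2 = 2 * (Λ ^ 2 / (8 * K ^ 2)) := by field_simp; norm_num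
    linarith

/-- Weighted energy inequality for each of the diagonal unknowns `u + σ p v`, `σ = ±1`. -/
theorem diagonal_energy (S : FluxSystem K Λ τ β lo hi a b A T ψ Z v u f)
    (R : FluxRoot K Λ a b A Z p) {σ : ℝ} (hσ : σ = 1 ∨ σ = -1)
    (hτ : 8 * K ^ 3 ≤ τ) (hhi : 1 ≤ hi) (hβ : K + 4 * hi * K ^ 2 + 1 ≤ β) :
    Λ ^ 2 / ((4 * hi * K) ^ 2 * τ) * (∫ y in a..b, ‖u y + σ * p y * v y‖ ^ 2) +
        (τ * ψ a + σ * ((p a).re / A a)) * ‖u a + σ * p a * v a‖ ^ 2 ≤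
      2 * (∫ y in a..b, ‖f y‖ ^ 2) + 2 * K ^ 2 * Λ ^ 2 * (∫ y in a..b, ‖v y‖ ^ 2) +
        (τ * ψ b + σ * ((p b).re / A b)) * ‖u b + σ * p b * v b‖ ^ 2 := by
  have hiv : IntervalIntegrable (fun y => ‖v y‖ ^ 2) volume a b :=
    S.ac_v.norm_sq.continuousOn.intervalIntegrable
  have e := weighted_energy (μ := Λ ^ 2 / ((4 * hi * K) ^ 2 * τ))
    (κ := fun y => τ * ψ y + σ * ((p y).re / A y))
    (G := fun y => 2 * ‖f y‖ ^ 2 + 2 * K ^ 2 * Λ ^ 2 * ‖v y‖ ^ 2) S.le (S.ac_mul_add R σ)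
    ((S.ac_psi.const_mul τ).add (R.ac_re.const_mul σ))
    ((S.int_f.const_mul _).add (hiv.const_mul _)) (by
      filter_upwards [S.deriv_psi, S.deriv_u, R.deriv, R.deriv_re] with y hd hu hp hr hy
      obtain ⟨d, hd, hd'⟩ := hd hy
      obtain ⟨dp, hdp, hdp'⟩ := hp
      obtain ⟨dr, hdr, hdr'⟩ := hr
      refine ⟨τ * d + σ * dr, -T y + σ * ((p y).im / A y), f y + σ * dp * v y, ?_,
        (hd.const_mul τ).add (hdr.const_mul σ), ?_, ?_⟩
      · have hσσ : (σ : ℂ) * σ = 1 := by rcases hσ with rfl | rfl <;> norm_num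
        have hA : (A y : ℂ) ≠ 0 := by exact_mod_cast (S.A_pos y).ne'
        refine HasDerivAt.congr_deriv
          ((hu hy).add ((hdp.const_mul (σ : ℂ)).mul (S.deriv_v y))) ?_
        have hpr : (((p y).re / A y : ℝ) : ℂ) + ((p y).im / A y : ℝ) * Complex.I = p y / A y := by
          push_cast
          rw [div_mul_eq_mul_div, ← add_div, Complex.re_add_im]
        have hZ : Z y = p y ^ 2 / A y := by rw [R.sq_eq y]; field_simp
        have hk : ((τ * ψ y + σ * ((p y).re / A y) : ℝ) : ℂ) +
            ((-T y + σ * ((p y).im / A y) : ℝ) : ℂ) * Complex.I =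
            (τ * ψ y : ℝ) - T y * Complex.I + σ * (p y / A y) := by
          rw [← hpr]; push_cast; ring
        rw [hk, hZ]
        linear_combination -(p y ^ 2 / A y * v y) * hσσ
      · exact weight_lower_bound hσ S.one_le_K hτ S.tau_le hhi hβ
          (by linarith [S.one_le_lo, S.lo_le y (Set.Ioo_subset_Icc_self hy)])
          (S.le_hi y (Set.Ioo_subset_Icc_self hy)) (R.le_re y) hd' hdr' rfl
      · have hσn : ‖(σ : ℂ)‖ = 1 := by rcases hσ with rfl | rfl <;> simp
        have h1 : ‖f y + σ * dp * v y‖ ≤ ‖f y‖ + K * Λ * ‖v y‖ := by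
          refine (norm_add_le _ _).trans ?_
          rw [norm_mul, norm_mul, hσn, one_mul]
          gcongr
        have h2 : ‖f y + σ * dp * v y‖ ^ 2 ≤ (‖f y‖ + K * Λ * ‖v y‖) ^ 2 := by gcongr
        nlinarith [sq_nonneg (K * Λ * ‖v y‖ - ‖f y‖)])
  rw [intervalIntegral.integral_add (S.int_f.const_mul _) (hiv.const_mul _),
    intervalIntegral.integral_const_mul, intervalIntegral.integral_const_mul] at e
  exact e

theorem diagonal_norm_sq (p u v : ℂ) :
    ‖u + (1 : ℝ) * p * v‖ ^ 2 + ‖u + (-1 : ℝ) * p * v‖ ^ 2 =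
      2 * ‖u‖ ^ 2 + 2 * (‖p‖ ^ 2 * ‖v‖ ^ 2) := by
  have h := parallelogram_law_with_norm ℝ u (p * v)
  have h1 : u + (1 : ℝ) * p * v = u + p * v := by push_cast; ring
  have h2 : u + (-1 : ℝ) * p * v = u - p * v := by push_cast; ring
  rw [h1, h2, ← mul_pow, ← norm_mul]
  linarith

theorem diagonal_integral_ge (S : FluxSystem K Λ τ β lo hi a b A T ψ Z v u f)
    (R : FluxRoot K Λ a b A Z p) :
    2 * (∫ y in a..b, ‖u y‖ ^ 2) + 2 * ((Λ / K) ^ 2 * ∫ y in a..b, ‖v y‖ ^ 2) ≤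
      (∫ y in a..b, ‖u y + (1 : ℝ) * p y * v y‖ ^ 2) +
        ∫ y in a..b, ‖u y + (-1 : ℝ) * p y * v y‖ ^ 2 := by
  have hK := S.one_le_K
  have hK0 : 0 < K := by linarith
  have hτ1 := S.one_le_tau
  have hτ0 : 0 < τ := by linarith
  have hΛ : 0 < Λ := by linarith [S.tau_le]
  have hiv : IntervalIntegrable (fun y => ‖v y‖ ^ 2) volume a b :=
    S.ac_v.norm_sq.continuousOn.intervalIntegrable
  have hiu : IntervalIntegrable (fun y => ‖u y‖ ^ 2) volume a b :=
    S.ac_u.norm_sq.continuousOn.intervalIntegrable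
  have hw : ∀ σ : ℝ, IntervalIntegrable (fun y => ‖u y + σ * p y * v y‖ ^ 2) volume a b :=
    fun σ => (S.ac_mul_add R σ).norm_sq.continuousOn.intervalIntegrable
  have hple : ∀ y, Λ / K ≤ ‖p y‖ := fun y => (R.le_norm y).trans (Complex.re_le_norm _)
  rw [← intervalIntegral.integral_add (hw 1) (hw (-1)), ← intervalIntegral.integral_const_mul,
    ← intervalIntegral.integral_const_mul, ← intervalIntegral.integral_const_mul,
    ← intervalIntegral.integral_add (hiu.const_mul _) ((hiv.const_mul _).const_mul _)]
  refine intervalIntegral.integral_mono_on S.le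
    ((hiu.const_mul _).add ((hiv.const_mul _).const_mul _)) ((hw 1).add (hw (-1))) fun y _ => ?_
  rw [diagonal_norm_sq]
  have := hple y
  gcongr

theorem diagonal_boundary_le (S : FluxSystem K Λ τ β lo hi a b A T ψ Z v u f)
    (R : FluxRoot K Λ a b A Z p) (hhi : 1 ≤ hi) {y : ℝ} (hy : y ∈ Set.Icc a b) :
    |τ * ψ y + (1 : ℝ) * ((p y).re / A y)| * ‖u y + (1 : ℝ) * p y * v y‖ ^ 2 +
      |τ * ψ y + (-1 : ℝ) * ((p y).re / A y)| * ‖u y + (-1 : ℝ) * p y * v y‖ ^ 2 ≤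
      2 * K ^ 2 * (hi + K) * (Λ * (Λ ^ 2 * ‖v y‖ ^ 2 + ‖u y‖ ^ 2)) := by
  have hK := S.one_le_K
  have hK0 : 0 < K := by linarith
  have hτ1 := S.one_le_tau
  have hτ0 : 0 < τ := by linarith
  have hΛ : 0 < Λ := by linarith [S.tau_le]
  have hb : ∀ σ : ℝ, (σ = 1 ∨ σ = -1) →
      |τ * ψ y + σ * ((p y).re / A y)| ≤ (hi + K) * Λ := by
    intro σ hσ
    have h1 : 0 ≤ ψ y := by linarith [S.one_le_lo, S.lo_le y hy]
    have h2 : τ * ψ y ≤ Λ * hi := mul_le_mul S.tau_le (S.le_hi y hy) h1 hΛ.le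
    have h3 : 0 ≤ τ * ψ y := by positivity
    have h4 := R.re_le y
    have h5 : 0 ≤ (p y).re / A y := le_trans (by positivity) (R.le_re y)
    have h6 : 0 ≤ Λ * hi := by positivity
    rcases hσ with rfl | rfl <;> rw [abs_le] <;> constructor <;> nlinarith
  have h1 := mul_le_mul_of_nonneg_right (hb 1 (Or.inl rfl))
    (sq_nonneg ‖u y + (1 : ℝ) * p y * v y‖)
  have h2 := mul_le_mul_of_nonneg_right (hb (-1) (Or.inr rfl))
    (sq_nonneg ‖u y + (-1 : ℝ) * p y * v y‖)
  have h3 := diagonal_norm_sq (p y) (u y) (v y)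
  have h4 : ‖p y‖ ^ 2 * ‖v y‖ ^ 2 ≤ (K * Λ) ^ 2 * ‖v y‖ ^ 2 := by
    have := R.norm_le y
    gcongr
  have h5 : ‖u y‖ ^ 2 ≤ K ^ 2 * ‖u y‖ ^ 2 :=
    le_mul_of_one_le_left (sq_nonneg _) (one_le_pow₀ hK)
  have h6 : 0 ≤ (hi + K) * Λ := by positivity
  have h7 : ‖u y + (1 : ℝ) * p y * v y‖ ^ 2 + ‖u y + (-1 : ℝ) * p y * v y‖ ^ 2 ≤
      2 * K ^ 2 * (Λ ^ 2 * ‖v y‖ ^ 2 + ‖u y‖ ^ 2) := by nlinarith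
  have h8 := mul_le_mul_of_nonneg_left h7 h6
  linarith

/-- Absorption step for `energy_of_root`. -/
theorem absorb_diagonal {K Λ τ hi Iv Iu If I1 I2 X : ℝ} (hK : 1 ≤ K) (hτ0 : 0 < τ) (hτΛ : τ ≤ Λ)
    (hhi : 1 ≤ hi) (hτ' : 4 * K ^ 4 * (4 * hi * K) ^ 2 ≤ τ) (hIv : 0 ≤ Iv) (hIu : 0 ≤ Iu)
    (hS : 2 * Iu + 2 * ((Λ / K) ^ 2 * Iv) ≤ I1 + I2)
    (hsum : Λ ^ 2 / ((4 * hi * K) ^ 2 * τ) * (I1 + I2) ≤ 4 * If + 4 * K ^ 2 * Λ ^ 2 * Iv + X) :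
    Λ ^ 2 / τ * (Λ ^ 2 * Iv + Iu) ≤ (4 * hi * K) ^ 2 * K ^ 2 * (4 * If + X) := by
  have hK0 : 0 < K := by linarith
  have hΛ : 0 < Λ := by linarith
  set μ := Λ ^ 2 / ((4 * hi * K) ^ 2 * τ) with hμ
  have hD : 0 < (4 * hi * K) ^ 2 := by positivity
  have hμ4 : 4 * K ^ 4 ≤ μ := by
    rw [hμ, le_div_iff₀ (by positivity)]
    have h1 : τ ^ 2 ≤ Λ ^ 2 := by gcongr
    have h2 := mul_le_mul_of_nonneg_right hτ' hτ0.le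
    nlinarith
  have hJ : 2 / K ^ 2 * (Λ ^ 2 * Iv + Iu) ≤ I1 + I2 := by
    have h1 : 2 / K ^ 2 * Iu ≤ 2 * Iu := by
      apply mul_le_mul_of_nonneg_right _ hIu
      rw [div_le_iff₀ (by positivity)]
      nlinarith
    have h2 : 2 / K ^ 2 * (Λ ^ 2 * Iv) = 2 * ((Λ / K) ^ 2 * Iv) := by field_simp
    rw [mul_add, h2]
    linarith
  have hv : 4 * K ^ 2 * Λ ^ 2 * Iv ≤ μ / 2 * (I1 + I2) := by
    have h1 : 4 * K ^ 2 * Λ ^ 2 * Iv ≤ 2 * K ^ 4 * (2 / K ^ 2 * (Λ ^ 2 * Iv + Iu)) := by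
      have : 2 * K ^ 4 * (2 / K ^ 2 * (Λ ^ 2 * Iv + Iu)) = 4 * K ^ 2 * (Λ ^ 2 * Iv + Iu) := by
        field_simp; ring
      rw [this]
      have : 0 ≤ K ^ 2 * Iu := by positivity
      linarith
    have h2 : 0 ≤ Λ ^ 2 * Iv + Iu := by positivity
    have h3 : 0 ≤ I1 + I2 := le_trans (by positivity) hJ
    calc _ ≤ _ := h1
      _ ≤ 2 * K ^ 4 * (I1 + I2) := by gcongr
      _ ≤ μ / 2 * (I1 + I2) := by
        apply mul_le_mul_of_nonneg_right _ h3
        linarith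
  have hfin : μ / 2 * (2 / K ^ 2 * (Λ ^ 2 * Iv + Iu)) ≤ 4 * If + X := by
    have : 0 ≤ μ / 2 := by positivity
    have := mul_le_mul_of_nonneg_left hJ this
    linarith
  have hfac : Λ ^ 2 / τ * (Λ ^ 2 * Iv + Iu) =
      (4 * hi * K) ^ 2 * K ^ 2 * (μ / 2 * (2 / K ^ 2 * (Λ ^ 2 * Iv + Iu))) := by
    rw [hμ]; field_simp
  rw [hfac]
  gcongr

/-- Bulk estimate in the diagonalisable regime, with the boundary values on the right. -/
theorem energy_of_root (S : FluxSystem K Λ τ β lo hi a b A T ψ Z v u f)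
    (R : FluxRoot K Λ a b A Z p)
    (hτ : 8 * K ^ 3 ≤ τ) (hτ' : 4 * K ^ 4 * (4 * hi * K) ^ 2 ≤ τ) (hhi : 1 ≤ hi)
    (hβ : K + 4 * hi * K ^ 2 + 1 ≤ β) :
    Λ ^ 2 / τ * (Λ ^ 2 * (∫ y in a..b, ‖v y‖ ^ 2) + ∫ y in a..b, ‖u y‖ ^ 2) ≤
      (4 * hi * K) ^ 2 * K ^ 2 * (4 * (∫ y in a..b, ‖f y‖ ^ 2) + 2 * K ^ 2 * (hi + K) *
        (Λ * (Λ ^ 2 * ‖v a‖ ^ 2 + ‖u a‖ ^ 2) + Λ * (Λ ^ 2 * ‖v b‖ ^ 2 + ‖u b‖ ^ 2))) := by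
  have hτ0 : 0 < τ := by linarith [S.one_le_tau]
  have e1 := S.diagonal_energy R (Or.inl rfl) hτ hhi hβ
  have e2 := S.diagonal_energy R (Or.inr rfl) hτ hhi hβ
  have ba := S.diagonal_boundary_le R hhi (Set.left_mem_Icc.mpr S.le)
  have bb := S.diagonal_boundary_le R hhi (Set.right_mem_Icc.mpr S.le)
  have n1 := fun y => mul_le_mul_of_nonneg_right
    (neg_abs_le (τ * ψ y + (1 : ℝ) * ((p y).re / A y))) (sq_nonneg ‖u y + (1 : ℝ) * p y * v y‖)
  have n2 := fun y => mul_le_mul_of_nonneg_right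
    (neg_abs_le (τ * ψ y + (-1 : ℝ) * ((p y).re / A y))) (sq_nonneg ‖u y + (-1 : ℝ) * p y * v y‖)
  have n3 := fun y => mul_le_mul_of_nonneg_right
    (le_abs_self (τ * ψ y + (1 : ℝ) * ((p y).re / A y))) (sq_nonneg ‖u y + (1 : ℝ) * p y * v y‖)
  have n4 := fun y => mul_le_mul_of_nonneg_right
    (le_abs_self (τ * ψ y + (-1 : ℝ) * ((p y).re / A y))) (sq_nonneg ‖u y + (-1 : ℝ) * p y * v y‖)
  have hIv : 0 ≤ ∫ y in a..b, ‖v y‖ ^ 2 :=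
    intervalIntegral.integral_nonneg S.le fun y _ => by positivity
  have hIu : 0 ≤ ∫ y in a..b, ‖u y‖ ^ 2 :=
    intervalIntegral.integral_nonneg S.le fun y _ => by positivity
  have m1 := n1 a
  have m2 := n2 a
  have m3 := n3 b
  have m4 := n4 b
  refine absorb_diagonal S.one_le_K hτ0 S.tau_le hhi hτ' hIv hIu (S.diagonal_integral_ge R) ?_
  rw [mul_add (2 * K ^ 2 * (hi + K)) (Λ * _) (Λ * _), mul_add (Λ ^ 2 / ((4 * hi * K) ^ 2 * τ))]
  linarith

end FluxSystem

namespace FluxSystem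

variable {K Λ τ β lo hi a b : ℝ} {A T ψ : ℝ → ℝ} {Z v u f p : ℝ → ℂ}

/-- Control of the outgoing trace `u + p v` at the left end point. -/
theorem trace_left (S : FluxSystem K Λ τ β lo hi a b A T ψ Z v u f)
    (R : FluxRoot K Λ a b A Z p)
    (hτ : 8 * K ^ 3 ≤ τ) (hhi : 1 ≤ hi) (hβ : K + 4 * hi * K ^ 2 + 1 ≤ β)
    (hv : v b = 0) (hu : u b = 0) :
    Λ / K * ‖u a + p a * v a‖ ^ 2 ≤
      2 * (∫ y in a..b, ‖f y‖ ^ 2) + 2 * K ^ 2 * (Λ ^ 2 * ∫ y in a..b, ‖v y‖ ^ 2) := by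
  have e := S.diagonal_energy R (Or.inl rfl) hτ hhi hβ
  have hI : 0 ≤ ∫ y in a..b, ‖u y + (1 : ℝ) * p y * v y‖ ^ 2 :=
    intervalIntegral.integral_nonneg S.le fun y _ => by positivity
  have hτ1 := S.one_le_tau
  have hμ : 0 ≤ Λ ^ 2 / ((4 * hi * K) ^ 2 * τ) := by positivity
  have h0 := mul_nonneg hμ hI
  have h1 : u a + (1 : ℝ) * p a * v a = u a + p a * v a := by push_cast; ring
  rw [hv, hu, h1] at e
  have h2 : Λ / K ≤ τ * ψ a + 1 * ((p a).re / A a) := by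
    have := R.le_re a
    have h3 : 0 ≤ ψ a := by linarith [S.one_le_lo, S.lo_le a (Set.left_mem_Icc.mpr S.le)]
    have : 0 ≤ τ * ψ a := by positivity
    linarith
  have h3 := mul_le_mul_of_nonneg_right h2 (sq_nonneg ‖u a + p a * v a‖)
  simp only [mul_zero, add_zero, norm_zero, ne_eq, OfNat.ofNat_ne_zero, not_false_eq_true,
    zero_pow] at e
  linarith

/-- Control of the trace `u - p v` at the right end point when `τψ` is dominated there. -/
theorem trace_right (S : FluxSystem K Λ τ β lo hi a b A T ψ Z v u f)
    (R : FluxRoot K Λ a b A Z p)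
    (hτ : 8 * K ^ 3 ≤ τ) (hhi : 1 ≤ hi) (hβ : K + 4 * hi * K ^ 2 + 1 ≤ β)
    (hv : v a = 0) (hu : u a = 0) (hdom : τ * ψ b ≤ Λ / (2 * K)) :
    Λ / (2 * K) * ‖u b - p b * v b‖ ^ 2 ≤
      2 * (∫ y in a..b, ‖f y‖ ^ 2) + 2 * K ^ 2 * (Λ ^ 2 * ∫ y in a..b, ‖v y‖ ^ 2) := by
  have e := S.diagonal_energy R (Or.inr rfl) hτ hhi hβ
  have hI : 0 ≤ ∫ y in a..b, ‖u y + (-1 : ℝ) * p y * v y‖ ^ 2 :=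
    intervalIntegral.integral_nonneg S.le fun y _ => by positivity
  have hτ1 := S.one_le_tau
  have hK := S.one_le_K
  have hμ : 0 ≤ Λ ^ 2 / ((4 * hi * K) ^ 2 * τ) := by positivity
  have h0 := mul_nonneg hμ hI
  have h1 : u b + (-1 : ℝ) * p b * v b = u b - p b * v b := by push_cast; ring
  rw [hv, hu, h1] at e
  have h2 : τ * ψ b + -1 * ((p b).re / A b) ≤ -(Λ / (2 * K)) := by
    have h4 := R.le_re b
    have h5 : Λ / (2 * K) = Λ / K / 2 := by field_simp
    linarith
  have h3 := mul_le_mul_of_nonneg_right h2 (sq_nonneg ‖u b - p b * v b‖)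
  simp only [mul_zero, add_zero, norm_zero, ne_eq, OfNat.ofNat_ne_zero, not_false_eq_true,
    zero_pow] at e
  linarith

theorem norm_drift_le (S : FluxSystem K Λ τ β lo hi a b A T ψ Z v u f)
    (hT : ∀ y, |T y| ≤ K * Λ) {y : ℝ} (hy : y ∈ Set.Icc a b) :
    ‖((τ * ψ y : ℝ) : ℂ) - T y * Complex.I‖ ≤ (hi + K) * Λ := by
  have h1 : 0 ≤ ψ y := by linarith [S.one_le_lo, S.lo_le y hy]
  have hτ1 := S.one_le_tau
  have h0 : 0 ≤ Λ := by linarith [S.tau_le]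
  have h2 : τ * ψ y ≤ Λ * hi := mul_le_mul S.tau_le (S.le_hi y hy) h1 h0
  have h3 : 0 ≤ τ * ψ y := by positivity
  refine (norm_sub_le _ _).trans ?_
  rw [norm_mul, Complex.norm_I, Complex.norm_real, Complex.norm_real, Real.norm_of_nonneg h3,
    Real.norm_eq_abs]
  linarith [hT y]

theorem norm_div_le (S : FluxSystem K Λ τ β lo hi a b A T ψ Z v u f) (z : ℂ) (y : ℝ) :
    ‖z / A y‖ ≤ K * ‖z‖ := by
  rw [norm_div, Complex.norm_real, Real.norm_of_nonneg (S.A_pos y).le, div_eq_mul_inv, mul_comm]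
  have := S.inv_le y
  gcongr

theorem norm_deriv_le (S : FluxSystem K Λ τ β lo hi a b A T ψ Z v u f)
    (hT : ∀ y, |T y| ≤ K * Λ) {y : ℝ} (hy : y ∈ Set.Icc a b) :
    ‖deriv v y‖ ≤ (hi + K) * (Λ * ‖v y‖ + ‖u y‖) := by
  rw [(S.deriv_v y).deriv]
  refine (norm_add_le _ _).trans ?_
  rw [norm_mul]
  have h1 := mul_le_mul_of_nonneg_right (S.norm_drift_le hT hy) (norm_nonneg (v y))
  have h2 := S.norm_div_le (u y) y
  have h3 : 0 ≤ hi := by linarith [S.one_le_lo, S.lo_le y hy, S.le_hi y hy]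
  nlinarith [norm_nonneg (u y)]

theorem norm_deriv_deriv_le (S : FluxSystem K Λ τ β lo hi a b A T ψ Z v u f)
    (hT : ∀ y, |T y| ≤ K * Λ) {y dψ dT dA : ℝ} (hy : y ∈ Set.Icc a b)
    (hψ : HasDerivAt ψ dψ y) (hTd : HasDerivAt T dT y) (hA : HasDerivAt A dA y)
    (hdψ : |dψ| ≤ β + K) (hdT : |dT| ≤ K * Λ) (hdA : |dA| ≤ K)
    (hu : HasDerivAt u (((τ * ψ y : ℝ) - T y * Complex.I) * u y + Z y * v y + f y) y) :
    ‖deriv (deriv v) y‖ ≤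
      3 * (hi + β + 2 * K) ^ 3 * (Λ ^ 2 * ‖v y‖ + Λ * ‖u y‖ + ‖f y‖) := by
  have hK := S.one_le_K
  have hτ1 := S.one_le_tau
  have hτΛ := S.tau_le
  have hhi : 1 ≤ hi := by linarith [S.one_le_lo, S.lo_le y hy, S.le_hi y hy]
  have hβ := S.K_le_beta
  have hder : deriv v = fun y => ((τ * ψ y : ℝ) - T y * Complex.I) * v y + u y / A y :=
    funext fun y => (S.deriv_v y).deriv
  have hAne : (A y : ℂ) ≠ 0 := by exact_mod_cast (S.A_pos y).ne'
  have hd := (((hψ.const_mul τ).ofReal_comp.sub (hTd.ofReal_comp.mul_const Complex.I)).mul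
    (S.deriv_v y)).add (hu.div hA.ofReal_comp hAne)
  rw [← (S.deriv_v y).deriv] at hd
  have hd2 : deriv (deriv v) y = (((τ * dψ : ℝ) : ℂ) - dT * Complex.I) * v y +
      (((τ * ψ y : ℝ) : ℂ) - T y * Complex.I) * deriv v y +
      ((((τ * ψ y : ℝ) - T y * Complex.I) * u y + Z y * v y + f y) * A y - u y * dA) /
        (A y : ℂ) ^ 2 := by
    conv_lhs => rw [hder]
    exact hd.deriv
  rw [hd2]
  set M := hi + β + 2 * K with hM
  have hM1 : 1 ≤ M := by linarith
  have hKM : K ≤ M := by linarith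
  have hM' : hi + K ≤ M := by linarith
  have hΛ0 : 0 ≤ Λ := by linarith
  have b1 : ‖((τ * dψ : ℝ) : ℂ) - dT * Complex.I‖ ≤ M * Λ := by
    refine (norm_sub_le _ _).trans ?_
    rw [norm_mul, Complex.norm_I, Complex.norm_real, Complex.norm_real, Real.norm_eq_abs,
      Real.norm_eq_abs, abs_mul, abs_of_nonneg (by linarith : 0 ≤ τ)]
    have : τ * |dψ| ≤ Λ * (β + K) := by gcongr
    nlinarith
  have b2 := S.norm_drift_le hT hy
  have b3 := S.norm_deriv_le hT hy
  have b2' : ‖((τ * ψ y : ℝ) : ℂ) - T y * Complex.I‖ ≤ M * Λ := b2.trans (by gcongr)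
  have b3' : ‖deriv v y‖ ≤ M * (Λ * ‖v y‖ + ‖u y‖) := b3.trans (by gcongr)
  have b4 : ‖((τ * ψ y : ℝ) - T y * Complex.I) * u y + Z y * v y + f y‖ ≤
      M * Λ * ‖u y‖ + M * Λ ^ 2 * ‖v y‖ + ‖f y‖ := by
    refine (norm_add₃_le).trans ?_
    rw [norm_mul, norm_mul]
    have := S.Z_le y
    gcongr
    exact this.trans (by gcongr)
  set du := ((τ * ψ y : ℝ) - T y * Complex.I) * u y + Z y * v y + f y
  have hq : (du * A y - u y * dA) / (A y : ℂ) ^ 2 = du / A y - u y / A y / A y * dA := by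
    field_simp
  rw [hq]
  have b5 : ‖du / A y‖ ≤ M * ‖du‖ := (S.norm_div_le du y).trans (by gcongr)
  have b6 : ‖u y / A y / A y * dA‖ ≤ M * (M * ‖u y‖) * M := by
    rw [norm_mul, Complex.norm_real, Real.norm_eq_abs]
    have h1 := S.norm_div_le (u y / A y) y
    have h2 := S.norm_div_le (u y) y
    have h3 : ‖u y / A y / A y‖ ≤ M * (M * ‖u y‖) :=
      h1.trans (by gcongr; exact h2.trans (by gcongr))
    gcongr
    exact hdA.trans hKM
  have hΛ1 : 1 ≤ Λ := by linarith
  have t1 := norm_add_le ((((τ * dψ : ℝ) : ℂ) - dT * Complex.I) * v y +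
    (((τ * ψ y : ℝ) : ℂ) - T y * Complex.I) * deriv v y) (du / A y - u y / A y / A y * dA)
  have t2 := norm_add_le ((((τ * dψ : ℝ) : ℂ) - dT * Complex.I) * v y)
    ((((τ * ψ y : ℝ) : ℂ) - T y * Complex.I) * deriv v y)
  have t3 := norm_sub_le (du / A y) (u y / A y / A y * dA)
  rw [norm_mul, norm_mul] at t2
  have c1 : ‖((τ * dψ : ℝ) : ℂ) - dT * Complex.I‖ * ‖v y‖ ≤ M * Λ * ‖v y‖ := by gcongr
  have c2 : ‖((τ * ψ y : ℝ) : ℂ) - T y * Complex.I‖ * ‖deriv v y‖ ≤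
      M * Λ * (M * (Λ * ‖v y‖ + ‖u y‖)) := by gcongr
  have c3 : M * ‖du‖ ≤ M * (M * Λ * ‖u y‖ + M * Λ ^ 2 * ‖v y‖ + ‖f y‖) := by gcongr
  have nv := norm_nonneg (v y)
  have nu := norm_nonneg (u y)
  have nf := norm_nonneg (f y)
  have M2 : M ≤ M ^ 3 := le_self_pow₀ hM1 (by norm_num)
  have M3 : M ^ 2 ≤ M ^ 3 := pow_le_pow_right₀ hM1 (by norm_num)
  have L2 : Λ ≤ Λ ^ 2 := le_self_pow₀ hΛ1 (by norm_num)
  have d1 : M * Λ * ‖v y‖ ≤ M ^ 3 * Λ ^ 2 * ‖v y‖ := by gcongr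
  have d2 : M ^ 2 * Λ ^ 2 * ‖v y‖ ≤ M ^ 3 * Λ ^ 2 * ‖v y‖ := by gcongr
  have d3 : M ^ 2 * Λ * ‖u y‖ ≤ M ^ 3 * Λ * ‖u y‖ := by gcongr
  have d4 : M * ‖f y‖ ≤ 3 * M ^ 3 * ‖f y‖ := by gcongr; nlinarith [pow_pos (by linarith : 0 < M) 3]
  have d5 : M ^ 3 * ‖u y‖ * 1 ≤ M ^ 3 * ‖u y‖ * Λ := by gcongr
  linarith

/-- The second-order left-hand side is controlled by the weighted norm of `(v, u)`. -/
theorem regularity (S : FluxSystem K Λ τ β lo hi a b A T ψ Z v u f) (hhi : 1 ≤ hi)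
    (hT : ∀ y, |T y| ≤ K * Λ)
    (hreg : ∀ᵐ y, y ∈ Set.Ioo a b → ∃ dψ dT dA, HasDerivAt ψ dψ y ∧ HasDerivAt T dT y ∧
      HasDerivAt A dA y ∧ |dψ| ≤ β + K ∧ |dT| ≤ K * Λ ∧ |dA| ≤ K)
    (hv1 : IntervalIntegrable (fun y => ‖deriv v y‖ ^ 2) volume a b)
    (hv2 : IntervalIntegrable (fun y => ‖deriv (deriv v) y‖ ^ 2) volume a b) :
    1 / τ * (∫ y in a..b, ‖deriv (deriv v) y‖ ^ 2) +
        Λ ^ 2 / τ * (∫ y in a..b, ‖deriv v y‖ ^ 2) + Λ ^ 4 / τ * (∫ y in a..b, ‖v y‖ ^ 2) ≤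
      30 * (hi + β + 2 * K) ^ 6 *
        (Λ ^ 2 / τ * (Λ ^ 2 * (∫ y in a..b, ‖v y‖ ^ 2) + ∫ y in a..b, ‖u y‖ ^ 2) +
          ∫ y in a..b, ‖f y‖ ^ 2) := by
  have hK := S.one_le_K
  have hτ1 := S.one_le_tau
  have hβ := S.K_le_beta
  have hiv : IntervalIntegrable (fun y => ‖v y‖ ^ 2) volume a b :=
    S.ac_v.norm_sq.continuousOn.intervalIntegrable
  have hiu : IntervalIntegrable (fun y => ‖u y‖ ^ 2) volume a b :=
    S.ac_u.norm_sq.continuousOn.intervalIntegrable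
  set M := hi + β + 2 * K with hM
  have hM1 : 1 ≤ M := by linarith
  have e1 : ∫ y in a..b, ‖deriv v y‖ ^ 2 ≤
      ∫ y in a..b, (2 * M ^ 2 * Λ ^ 2 * ‖v y‖ ^ 2 + 2 * M ^ 2 * ‖u y‖ ^ 2) := by
    refine intervalIntegral.integral_mono_on S.le hv1
      ((hiv.const_mul _).add (hiu.const_mul _)) fun y hy => ?_
    have h1 := S.norm_deriv_le hT hy
    have h0 : 0 ≤ Λ := by linarith [S.tau_le]
    have h2 : ‖deriv v y‖ ≤ M * (Λ * ‖v y‖ + ‖u y‖) := h1.trans (by gcongr; linarith)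
    have h3 : ‖deriv v y‖ ^ 2 ≤ (M * (Λ * ‖v y‖ + ‖u y‖)) ^ 2 := by gcongr
    have h4 := mul_nonneg (sq_nonneg M) (sq_nonneg (Λ * ‖v y‖ - ‖u y‖))
    linarith
  have e2 : ∫ y in a..b, ‖deriv (deriv v) y‖ ^ 2 ≤
      ∫ y in a..b, (27 * M ^ 6 * Λ ^ 4 * ‖v y‖ ^ 2 + 27 * M ^ 6 * Λ ^ 2 * ‖u y‖ ^ 2 +
        27 * M ^ 6 * ‖f y‖ ^ 2) := by
    refine intervalIntegral.integral_mono_ae_restrict S.le hv2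
      (((hiv.const_mul _).add (hiu.const_mul _)).add (S.int_f.const_mul _)) ?_
    rw [Filter.EventuallyLE, ae_restrict_iff' measurableSet_Icc]
    have hn1 : ∀ᵐ y : ℝ, y ≠ a := by simp [ae_iff]
    have hn2 : ∀ᵐ y : ℝ, y ≠ b := by simp [ae_iff]
    filter_upwards [hreg, S.deriv_u, hn1, hn2] with y hr hu h1 h2 hmem
    have hy : y ∈ Set.Ioo a b :=
      ⟨lt_of_le_of_ne hmem.1 (Ne.symm h1), lt_of_le_of_ne hmem.2 h2⟩
    obtain ⟨dψ, dT, dA, q1, q2, q3, q4, q5, q6⟩ := hr hy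
    have h3 := S.norm_deriv_deriv_le hT hmem q1 q2 q3 q4 q5 q6 (hu hy)
    rw [← hM] at h3
    have h4 : ‖deriv (deriv v) y‖ ^ 2 ≤
      (3 * M ^ 3 * (Λ ^ 2 * ‖v y‖ + Λ * ‖u y‖ + ‖f y‖)) ^ 2 := by gcongr
    have h5 : (Λ ^ 2 * ‖v y‖ + Λ * ‖u y‖ + ‖f y‖) ^ 2 ≤
        3 * ((Λ ^ 2 * ‖v y‖) ^ 2 + (Λ * ‖u y‖) ^ 2 + ‖f y‖ ^ 2) := by
      nlinarith [sq_nonneg (Λ ^ 2 * ‖v y‖ - Λ * ‖u y‖), sq_nonneg (Λ ^ 2 * ‖v y‖ - ‖f y‖),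
        sq_nonneg (Λ * ‖u y‖ - ‖f y‖)]
    have h6 := mul_le_mul_of_nonneg_left h5 (by positivity : 0 ≤ 9 * M ^ 6)
    linarith
  rw [intervalIntegral.integral_add (hiv.const_mul _) (hiu.const_mul _),
    intervalIntegral.integral_const_mul, intervalIntegral.integral_const_mul] at e1
  rw [intervalIntegral.integral_add ((hiv.const_mul _).add (hiu.const_mul _))
    (S.int_f.const_mul _), intervalIntegral.integral_add (hiv.const_mul _) (hiu.const_mul _),
    intervalIntegral.integral_const_mul, intervalIntegral.integral_const_mul,
    intervalIntegral.integral_const_mul] at e2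
  have hIv : 0 ≤ ∫ y in a..b, ‖v y‖ ^ 2 :=
    intervalIntegral.integral_nonneg S.le fun y _ => by positivity
  have hIu : 0 ≤ ∫ y in a..b, ‖u y‖ ^ 2 :=
    intervalIntegral.integral_nonneg S.le fun y _ => by positivity
  have hIf : 0 ≤ ∫ y in a..b, ‖f y‖ ^ 2 :=
    intervalIntegral.integral_nonneg S.le fun y _ => by positivity
  set Iv := ∫ y in a..b, ‖v y‖ ^ 2
  set Iu := ∫ y in a..b, ‖u y‖ ^ 2
  set If := ∫ y in a..b, ‖f y‖ ^ 2
  have hτi : 0 ≤ 1 / τ := by positivity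
  have hτi1 : 1 / τ ≤ 1 := by rw [div_le_one (by linarith)]; exact hτ1
  have f1 := mul_le_mul_of_nonneg_left e2 hτi
  have f2 := mul_le_mul_of_nonneg_left e1 (mul_nonneg (sq_nonneg Λ) hτi)
  have hM6 : 1 ≤ M ^ 6 := one_le_pow₀ hM1
  have hM2 : M ^ 2 ≤ M ^ 6 := pow_le_pow_right₀ hM1 (by norm_num)
  have f3 : 1 / τ * (27 * M ^ 6 * If) ≤ 1 * (27 * M ^ 6 * If) := by gcongr
  have r1 : 0 ≤ Λ ^ 4 * (1 / τ) * Iv := by positivity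
  have r2 : 0 ≤ Λ ^ 2 * (1 / τ) * Iu := by positivity
  have s1 := mul_le_mul_of_nonneg_right hM2 r1
  have s2 := mul_le_mul_of_nonneg_right hM2 r2
  have s3 := mul_le_mul_of_nonneg_right hM6 r1
  have s4 := mul_le_mul_of_nonneg_right hM6 r2
  have s5 := mul_le_mul_of_nonneg_right hM6 hIf
  have q4 : Λ ^ 4 / τ = Λ ^ 4 * (1 / τ) := by ring
  have q2 : Λ ^ 2 / τ = Λ ^ 2 * (1 / τ) := by ring
  rw [q4, q2]
  linarith

end FluxSystem

/-- The transmission traces are controlled by the two outgoing combinations and the jumps. -/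
theorem transmission_trace {K Λ : ℝ} (hK : 1 ≤ K) (hΛ : 0 < Λ) {vp vm up um pp pm : ℂ}
    (hpp : ‖pp‖ ≤ K * Λ) (hpm : ‖pm‖ ≤ K * Λ) (hrp : Λ / K ≤ pp.re) (hrm : Λ / K ≤ pm.re) :
    (Λ ^ 2 * ‖vp‖ ^ 2 + ‖up‖ ^ 2) + (Λ ^ 2 * ‖vm‖ ^ 2 + ‖um‖ ^ 2) ≤
      17 * K ^ 6 * (‖up + pp * vp‖ ^ 2 + ‖um - pm * vm‖ ^ 2 + ‖up - um‖ ^ 2 +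
        Λ ^ 2 * ‖vp - vm‖ ^ 2) := by
  have hK0 : 0 < K := by linarith
  set W1 := up + pp * vp with hW1
  set W2 := um - pm * vm with hW2
  set e1 := up - um with he1
  set e0 := vp - vm with he0
  have hid : (pp + pm) * vm = W1 - W2 - e1 - pp * e0 := by
    rw [hW1, hW2, he1, he0]; ring
  have hre : 2 * (Λ / K) ≤ ‖pp + pm‖ := by
    refine le_trans ?_ (Complex.re_le_norm _)
    rw [Complex.add_re]; linarith
  have two : ∀ x y : ℝ, (x + y) ^ 2 ≤ 2 * x ^ 2 + 2 * y ^ 2 := fun x y => by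
    nlinarith [sq_nonneg (x - y)]
  have h1 : ‖W1 - W2 - e1 - pp * e0‖ ≤ ‖W1‖ + ‖W2‖ + ‖e1‖ + K * Λ * ‖e0‖ := by
    refine (norm_sub_le _ _).trans ?_
    rw [norm_mul]
    gcongr
    refine (norm_sub_le _ _).trans ?_
    gcongr
    exact norm_sub_le _ _
  rw [← hid, norm_mul] at h1
  have h2 : 2 * (Λ / K) * ‖vm‖ ≤ ‖W1‖ + ‖W2‖ + ‖e1‖ + K * Λ * ‖e0‖ :=
    le_trans (by gcongr) h1
  have h3 : (2 * (Λ / K) * ‖vm‖) ^ 2 ≤ (‖W1‖ + ‖W2‖ + ‖e1‖ + K * Λ * ‖e0‖) ^ 2 := by gcongr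
  set Q := ‖W1‖ ^ 2 + ‖W2‖ ^ 2 + ‖e1‖ ^ 2 + Λ ^ 2 * ‖e0‖ ^ 2 with hQ
  have hK2 : 1 ≤ K ^ 2 := one_le_pow₀ hK
  have h4 : (‖W1‖ + ‖W2‖ + ‖e1‖ + K * Λ * ‖e0‖) ^ 2 ≤ 4 * K ^ 2 * Q := by
    have a1 := two (‖W1‖ + ‖W2‖) (‖e1‖ + K * Λ * ‖e0‖)
    have a2 := two ‖W1‖ ‖W2‖
    have a3 := two ‖e1‖ (K * Λ * ‖e0‖)
    have a4 := mul_le_mul_of_nonneg_right hK2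
      (by positivity : 0 ≤ ‖W1‖ ^ 2 + ‖W2‖ ^ 2 + ‖e1‖ ^ 2)
    rw [hQ]
    linarith
  have hvm : Λ ^ 2 * ‖vm‖ ^ 2 ≤ K ^ 4 * Q := by
    have : (2 * (Λ / K) * ‖vm‖) ^ 2 * (K ^ 2 / 4) = Λ ^ 2 * ‖vm‖ ^ 2 := by field_simp; ring
    rw [← this]
    have := mul_le_mul_of_nonneg_right (h3.trans h4) (by positivity : 0 ≤ K ^ 2 / 4)
    linarith
  have hQ0 : 0 ≤ Q := by positivity
  have hW1Q : ‖W1‖ ^ 2 ≤ Q := by rw [hQ]; nlinarith [sq_nonneg ‖W2‖, sq_nonneg ‖e1‖, mul_nonneg (sq_nonneg Λ) (sq_nonneg ‖e0‖)]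
  have hW2Q : ‖W2‖ ^ 2 ≤ Q := by rw [hQ]; nlinarith [sq_nonneg ‖W1‖, sq_nonneg ‖e1‖, mul_nonneg (sq_nonneg Λ) (sq_nonneg ‖e0‖)]
  have hEQ : ‖e1‖ ^ 2 + Λ ^ 2 * ‖e0‖ ^ 2 ≤ Q := by
    rw [hQ]; nlinarith [sq_nonneg ‖W1‖, sq_nonneg ‖W2‖]
  have hum : ‖um‖ ^ 2 ≤ 2 * Q + 2 * K ^ 6 * Q := by
    have b1 : ‖um‖ ≤ ‖W2‖ + K * (Λ * ‖vm‖) := by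
      have : um = W2 + pm * vm := by rw [hW2]; ring
      rw [this]
      refine (norm_add_le _ _).trans ?_
      rw [norm_mul, ← mul_assoc]
      gcongr
    have b2 : ‖um‖ ^ 2 ≤ (‖W2‖ + K * (Λ * ‖vm‖)) ^ 2 := by gcongr
    have b3 := two ‖W2‖ (K * (Λ * ‖vm‖))
    have b4 := mul_le_mul_of_nonneg_left hvm (sq_nonneg K)
    linarith
  have hvp : Λ ^ 2 * ‖vp‖ ^ 2 ≤ 2 * (Λ ^ 2 * ‖vm‖ ^ 2) + 2 * (Λ ^ 2 * ‖e0‖ ^ 2) := by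
    have b1 : ‖vp‖ ≤ ‖vm‖ + ‖e0‖ := by
      have : vp = vm + e0 := by rw [he0]; ring
      rw [this]; exact norm_add_le _ _
    have b2 : ‖vp‖ ^ 2 ≤ (‖vm‖ + ‖e0‖) ^ 2 := by gcongr
    have b3 := mul_le_mul_of_nonneg_left (b2.trans (two _ _)) (sq_nonneg Λ)
    linarith
  have hup : ‖up‖ ^ 2 ≤ 2 * ‖um‖ ^ 2 + 2 * ‖e1‖ ^ 2 := by
    have b1 : ‖up‖ ≤ ‖um‖ + ‖e1‖ := by
      have : up = um + e1 := by rw [he1]; ring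
      rw [this]; exact norm_add_le _ _
    have b2 : ‖up‖ ^ 2 ≤ (‖um‖ + ‖e1‖) ^ 2 := by gcongr
    linarith [two ‖um‖ ‖e1‖]
  have k6 : Q ≤ K ^ 6 * Q := le_mul_of_one_le_left hQ0 (one_le_pow₀ hK)
  have k4 : K ^ 4 * Q ≤ K ^ 6 * Q := by gcongr; norm_num [hK]
  linarith

/-- `f` is bounded by `C` and Lipschitz with constant `C`. -/
def BddLip {E : Type*} [NormedAddCommGroup E] (C : ℝ) (f : ℝ → E) : Prop :=
  (∀ y, ‖f y‖ ≤ C) ∧ ∀ y y', ‖f y - f y'‖ ≤ C * |y - y'|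

namespace BddLip

section Basic

variable {E : Type*} [NormedAddCommGroup E] {C D : ℝ} {f g : ℝ → E}

theorem nonneg (h : BddLip C f) : 0 ≤ C := (norm_nonneg _).trans (h.1 0)

theorem mono (h : BddLip C f) (hCD : C ≤ D) : BddLip D f :=
  ⟨fun y => (h.1 y).trans hCD, fun y y' => (h.2 y y').trans (by gcongr)⟩

theorem add (hf : BddLip C f) (hg : BddLip D g) : BddLip (C + D) (fun y => f y + g y) := by
  refine ⟨fun y => (norm_add_le _ _).trans (add_le_add (hf.1 y) (hg.1 y)), fun y y' => ?_⟩
  have : f y + g y - (f y' + g y') = (f y - f y') + (g y - g y') := by abel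
  rw [this, add_mul]
  exact (norm_add_le _ _).trans (add_le_add (hf.2 y y') (hg.2 y y'))

theorem sum {ι : Type*} (s : Finset ι) {C : ι → ℝ} {f : ι → ℝ → E}
    (h : ∀ i ∈ s, BddLip (C i) (f i)) : BddLip (∑ i ∈ s, C i) (fun y => ∑ i ∈ s, f i y) := by
  refine ⟨fun y => norm_sum_le_of_le _ fun i hi => (h i hi).1 y, fun y y' => ?_⟩
  rw [← Finset.sum_sub_distrib, Finset.sum_mul]
  exact norm_sum_le_of_le _ fun i hi => (h i hi).2 y y'

theorem lipschitzWith (h : BddLip C f) : LipschitzWith C.toNNReal f :=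
  LipschitzWith.of_dist_le_mul fun y y' => by
    rw [dist_eq_norm, Real.dist_eq, Real.coe_toNNReal _ h.nonneg]
    exact h.2 y y'

theorem continuous (h : BddLip C f) : Continuous f := h.lipschitzWith.continuous

theorem absolutelyContinuousOnInterval (h : BddLip C f) (a b : ℝ) :
    AbsolutelyContinuousOnInterval f a b :=
  (h.lipschitzWith.lipschitzOnWith).absolutelyContinuousOnInterval

theorem norm_deriv_le [NormedSpace ℝ E] (h : BddLip C f) (y : ℝ) : ‖deriv f y‖ ≤ C := by
  have := norm_deriv_le_of_lipschitz (x₀ := y) h.lipschitzWith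
  rwa [Real.coe_toNNReal _ h.nonneg] at this

theorem ae_hasDerivAt [NormedSpace ℝ E] [FiniteDimensional ℝ E] (h : BddLip C f) :
    ∀ᵐ y, ∃ d, HasDerivAt f d y ∧ ‖d‖ ≤ C := by
  filter_upwards [h.lipschitzWith.ae_differentiableAt_real] with y hy
  exact ⟨_, hy.hasDerivAt, h.norm_deriv_le y⟩

end Basic

section Ring

variable {R : Type*} [NormedRing R] {C D : ℝ} {f g : ℝ → R}

theorem mul (hf : BddLip C f) (hg : BddLip D g) : BddLip (2 * C * D) (fun y => f y * g y) := by
  have hC := hf.nonneg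
  have hD := hg.nonneg
  have hCD := mul_nonneg hC hD
  refine ⟨fun y => ?_, fun y y' => ?_⟩
  · have := (norm_mul_le (f y) (g y)).trans (mul_le_mul (hf.1 y) (hg.1 y) (norm_nonneg _) hC)
    linarith
  · have h1 : f y * g y - f y' * g y' = (f y - f y') * g y + f y' * (g y - g y') := by
      noncomm_ring
    have h2 := (norm_mul_le (f y - f y') (g y)).trans
      (mul_le_mul (hf.2 y y') (hg.1 y) (norm_nonneg _) (by positivity))
    have h3 := (norm_mul_le (f y') (g y - g y')).trans
      (mul_le_mul (hf.1 y') (hg.2 y y') (norm_nonneg _) hC)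
    rw [h1]
    refine (norm_add_le _ _).trans ?_
    linarith

theorem const_mul (c : R) (hf : BddLip C f) : BddLip (‖c‖ * C) (fun y => c * f y) := by
  refine ⟨fun y => (norm_mul_le _ _).trans (by gcongr; exact hf.1 y), fun y y' => ?_⟩
  rw [← mul_sub, mul_assoc]
  exact (norm_mul_le _ _).trans (by gcongr; exact hf.2 y y')

end Ring

theorem inv {C k : ℝ} {f : ℝ → ℝ} (hf : BddLip C f) (hk : 1 ≤ k) (hC : k ≤ C)
    (hpos : ∀ y, 0 < f y) (hinv : ∀ y, (f y)⁻¹ ≤ k) :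
    BddLip (k ^ 2 * C) (fun y => (f y)⁻¹) := by
  have hC0 := hf.nonneg
  have h0 : ∀ y, ‖(f y)⁻¹‖ ≤ k := fun y => by
    rw [Real.norm_of_nonneg (inv_pos.mpr (hpos y)).le]; exact hinv y
  refine ⟨fun y => (h0 y).trans ?_, fun y y' => ?_⟩
  · nlinarith
  · have h1 : (f y)⁻¹ - (f y')⁻¹ = (f y)⁻¹ * (f y')⁻¹ * (f y' - f y) := by
      have := (hpos y).ne'
      have := (hpos y').ne'
      field_simp
    rw [h1, norm_mul, norm_mul, norm_sub_rev]
    calc ‖(f y)⁻¹‖ * ‖(f y')⁻¹‖ * ‖f y - f y'‖ ≤ k * k * (C * |y - y'|) := by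
          gcongr
          · exact h0 y
          · exact h0 y'
          · exact hf.2 y y'
      _ = k ^ 2 * C * |y - y'| := by ring

theorem ofReal {C : ℝ} {f : ℝ → ℝ} (hf : BddLip C f) : BddLip C (fun y => (f y : ℂ)) :=
  ⟨fun y => by rw [Complex.norm_real]; exact hf.1 y, fun y y' => by
    rw [← Complex.ofReal_sub, Complex.norm_real]; exact hf.2 y y'⟩

theorem re {C : ℝ} {f : ℝ → ℂ} (hf : BddLip C f) : BddLip C (fun y => (f y).re) :=
  ⟨fun y => (Complex.abs_re_le_norm _).trans (hf.1 y), fun y y' => by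
    rw [← Complex.sub_re]; exact (Complex.abs_re_le_norm _).trans (hf.2 y y')⟩

theorem exists_of_contDiff {w : ℝ → ℂ} (hw : ContDiff ℝ 1 w) (hc : HasCompactSupport w) :
    ∃ C, BddLip C w := by
  obtain ⟨C₁, h₁⟩ := hc.exists_bound_of_continuous hw.continuous
  obtain ⟨C₂, h₂⟩ := hw.lipschitzWith_of_hasCompactSupport hc one_ne_zero
  refine ⟨max C₁ C₂, fun y => (h₁ y).trans (le_max_left _ _), fun y y' => ?_⟩
  have := h₂.dist_le_mul y y'
  rw [dist_eq_norm, Real.dist_eq] at this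
  exact this.trans (by gcongr; exact le_max_right _ _)

/-- A square root with positive real part inherits boundedness and Lipschitz continuity. -/
theorem exists_sqrt {Λ Q k : ℝ} {G : ℝ → ℂ} (hΛ : 0 < Λ) (hQ : 1 ≤ Q) (hk : 1 ≤ k)
    (hG : BddLip (Q * Λ ^ 2) G) (hre : ∀ y, Λ ^ 2 / (4 * k ^ 2) ≤ (G y).re) :
    ∃ p : ℝ → ℂ, (∀ y, p y ^ 2 = G y) ∧ (∀ y, Λ / (2 * k) ≤ (p y).re) ∧
      BddLip (k * Q * Λ) p := by
  have hex : ∀ z : ℂ, ∃ w : ℂ, w ^ 2 = z ∧ 0 ≤ w.re := fun z => by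
    obtain ⟨w, hw⟩ := IsAlgClosed.exists_pow_nat_eq z (n := 2) (by norm_num)
    rcases le_total 0 w.re with h | h
    · exact ⟨w, hw, h⟩
    · exact ⟨-w, by rw [neg_sq, hw], by rw [Complex.neg_re]; linarith⟩
  choose r hr hr0 using hex
  have hp : ∀ y, r (G y) ^ 2 = G y := fun y => hr _
  have hlow : ∀ y, Λ / (2 * k) ≤ (r (G y)).re := fun y => by
    refine le_of_sq_le_sq ?_ (hr0 _)
    have h1 : (G y).re = (r (G y)).re ^ 2 - (r (G y)).im ^ 2 := by
      conv_lhs => rw [← hp y, sq, Complex.mul_re]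
      ring
    have h2 : (Λ / (2 * k)) ^ 2 = Λ ^ 2 / (4 * k ^ 2) := by ring
    rw [h2]
    nlinarith [hre y, sq_nonneg (r (G y)).im]
  refine ⟨fun y => r (G y), hp, hlow, fun y => ?_, fun y y' => ?_⟩
  · refine le_of_sq_le_sq ?_ (by positivity)
    rw [← norm_pow, hp]
    have h1 : Q * Λ ^ 2 ≤ (k * Q * Λ) ^ 2 := by
      have : Q ≤ (k * Q) ^ 2 := by nlinarith [mul_le_mul hk hQ zero_le_one (by linarith)]
      calc Q * Λ ^ 2 ≤ (k * Q) ^ 2 * Λ ^ 2 := by gcongr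
        _ = _ := by ring
    exact (hG.1 y).trans h1
  · have h1 : (r (G y) - r (G y')) * (r (G y) + r (G y')) = G y - G y' := by
      rw [← hp y, ← hp y', hp y, hp y']
      linear_combination hp y - hp y'
    have h2 : Λ / k ≤ ‖r (G y) + r (G y')‖ := by
      refine le_trans ?_ (Complex.re_le_norm _)
      rw [Complex.add_re]
      have : Λ / k = Λ / (2 * k) + Λ / (2 * k) := by field_simp; ring
      linarith [hlow y, hlow y']
    have h3 := hG.2 y y'
    rw [← h1, norm_mul] at h3
    have h4 : ‖r (G y) - r (G y')‖ * (Λ / k) ≤ Q * Λ ^ 2 * |y - y'| :=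
      le_trans (by gcongr) h3
    have h5 : 0 < Λ / k := by positivity
    refine le_of_mul_le_mul_right (h4.trans (le_of_eq ?_)) h5
    field_simp

end BddLip

/-- The bounds on the symbols at frequency `ξ` that enter the estimates. -/
structure CoeffBounds (K Λ : ℝ) (a : ℝ → Matrix (Fin (m + 1)) (Fin (m + 1)) ℝ) (ξ γ : Em m)
    (τ s : ℝ) : Prop where
  ann_pos : ∀ y, 0 < ann a y
  inv_le : ∀ y, (ann a y)⁻¹ ≤ K
  ann : BddLip K (ann a)
  tform_xi : BddLip (K * Λ) (tform a ξ)
  tform_gamma : BddLip K (tform a γ)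
  symbol : BddLip (K * Λ ^ 2) (fun y => (_root_.ann a y : ℂ) * zetafun a ξ γ τ s y)

/-- The square root of the principal symbol, with its bounds. -/
structure RootBounds (K Λ : ℝ) (a : ℝ → Matrix (Fin (m + 1)) (Fin (m + 1)) ℝ) (ξ γ : Em m)
    (τ s : ℝ) (p : ℝ → ℂ) : Prop where
  sq_eq : ∀ y, p y ^ 2 = ann a y * ((ann a y : ℂ) * zetafun a ξ γ τ s y)
  bddLip : BddLip (K * Λ) p
  le_re : ∀ y, Λ / K ≤ (p y).re
  bddLip_div : BddLip (K * Λ) (fun y => (p y).re / ann a y)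
  le_div : ∀ y, Λ / K ≤ (p y).re / ann a y

namespace GoodCoeff

variable {lam0 M0 : ℝ} {a : ℝ → Matrix (Fin (m + 1)) (Fin (m + 1)) ℝ}

theorem quadratic_single_add (h : GoodCoeff lam0 M0 a) (hlam : 0 < lam0) (y : ℝ)
    (i j : Fin (m + 1)) (ε : ℝ) (hε : |ε| ≤ 1) :
    0 ≤ a y i i + 2 * ε * a y i j + ε ^ 2 * a y j j ∧
      a y i i + 2 * ε * a y i j + ε ^ 2 * a y j j ≤ 4 * lam0⁻¹ := by
  have hsym : a y j i = a y i j := (h.1 y).apply i j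
  obtain ⟨h1, h2⟩ := h.2.1 y (EuclideanSpace.single i 1 + EuclideanSpace.single j ε)
  have hq : ∑ k, ∑ l, a y k l *
      (EuclideanSpace.single i (1 : ℝ) + EuclideanSpace.single j ε : EuclideanSpace ℝ _) k *
      (EuclideanSpace.single i (1 : ℝ) + EuclideanSpace.single j ε : EuclideanSpace ℝ _) l =
      a y i i + 2 * ε * a y i j + ε ^ 2 * a y j j := by
    simp only [PiLp.add_apply, PiLp.single_apply, mul_add, add_mul,
      Finset.sum_add_distrib, mul_ite, mul_one, mul_zero, ite_mul, zero_mul, Finset.sum_ite_eq',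
      Finset.mem_univ, if_true, hsym]
    ring
  rw [hq] at h1 h2
  refine ⟨le_trans (by positivity) h1, h2.trans ?_⟩
  have hn : ‖(EuclideanSpace.single i (1 : ℝ) + EuclideanSpace.single j ε :
      EuclideanSpace ℝ (Fin (m + 1)))‖ ≤ 2 := by
    refine (norm_add_le _ _).trans ?_
    rw [PiLp.norm_single, PiLp.norm_single, norm_one, Real.norm_eq_abs]
    linarith
  have : ‖(EuclideanSpace.single i (1 : ℝ) + EuclideanSpace.single j ε :
      EuclideanSpace ℝ (Fin (m + 1)))‖ ^ 2 ≤ 2 ^ 2 := by gcongr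
  have := mul_le_mul_of_nonneg_left this (inv_pos.mpr hlam).le
  linarith

theorem bddLip_entry (h : GoodCoeff lam0 M0 a) (hlam : 0 < lam0) {k : ℝ} (hk : lam0⁻¹ ≤ k)
    (hM : M0 ≤ k) (i j : Fin (m + 1)) : BddLip k (fun y => a y i j) := by
  refine ⟨fun y => ?_, fun y y' => (h.2.2 y y' i j).trans (by gcongr)⟩
  obtain ⟨h1, h2⟩ := h.quadratic_single_add hlam y i j 1 (by simp)
  obtain ⟨h3, h4⟩ := h.quadratic_single_add hlam y i j (-1) (by simp)
  rw [Real.norm_eq_abs, abs_le]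
  constructor <;> linarith

theorem le_ann (h : GoodCoeff lam0 M0 a) (y : ℝ) : lam0 ≤ ann a y := by
  have h1 := (h.2.1 y (EuclideanSpace.single (Fin.last m) 1)).1
  rw [PiLp.norm_single, norm_one] at h1
  simp only [PiLp.single_apply, mul_ite, mul_one, mul_zero, Finset.sum_ite_eq',
    Finset.mem_univ, if_true, one_pow] at h1
  exact h1

theorem bddLip_ann_inv (h : GoodCoeff lam0 M0 a) (hlam : 0 < lam0) {k : ℝ} (hk1 : 1 ≤ k)
    (hk : lam0⁻¹ ≤ k) (hM : M0 ≤ k) : BddLip (k ^ 3) (fun y => (ann a y)⁻¹) := by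
  have h1 : BddLip k (ann a) := h.bddLip_entry hlam hk hM _ _
  have h2 := h1.inv hk1 le_rfl (fun y => hlam.trans_le (h.le_ann y))
    (fun y => (inv_anti₀ hlam (h.le_ann y)).trans hk)
  exact h2.mono (by ring_nf; rfl)

theorem bddLip_bcoef (h : GoodCoeff lam0 M0 a) (hlam : 0 < lam0) {k : ℝ} (hk1 : 1 ≤ k)
    (hk : lam0⁻¹ ≤ k) (hM : M0 ≤ k) (i j : Fin m) : BddLip (5 * k ^ 5) (bcoef a i j) := by
  have e := fun i j => h.bddLip_entry hlam hk hM i j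
  have h1 := (e i.castSucc j.castSucc).add ((((e (Fin.last m) i.castSucc).mul
    (e (Fin.last m) j.castSucc)).mul (h.bddLip_ann_inv hlam hk1 hk hM)).const_mul (-1))
  have h2 : k ≤ k ^ 5 := le_self_pow₀ hk1 (by norm_num)
  have h3 : bcoef a i j = fun y => a y i.castSucc j.castSucc + -1 * (a y (Fin.last m) i.castSucc *
      a y (Fin.last m) j.castSucc * (ann a y)⁻¹) := by
    funext y; simp only [bcoef]; ring
  rw [h3]
  refine h1.mono ?_
  rw [norm_neg, norm_one]
  ring_nf
  linarith

theorem bddLip_Bform (h : GoodCoeff lam0 M0 a) (hlam : 0 < lam0) {k : ℝ} (hk1 : 1 ≤ k)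
    (hk : lam0⁻¹ ≤ k) (hM : M0 ≤ k) (ξ η : Em m) :
    BddLip (5 * m ^ 2 * k ^ 5 * (‖ξ‖ * ‖η‖)) (Bform a ξ η) := by
  have h1 : BddLip (∑ _i : Fin m, ∑ _j : Fin m, 5 * k ^ 5 * (‖ξ‖ * ‖η‖)) (Bform a ξ η) := by
    refine BddLip.sum _ fun i _ => BddLip.sum _ fun j _ => ?_
    have h2 := (h.bddLip_bcoef hlam hk1 hk hM i j).const_mul (ξ i * η j)
    have h3 : (fun y => bcoef a i j y * ξ i * η j) = fun y => ξ i * η j * bcoef a i j y :=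
      funext fun y => by ring
    rw [h3]
    refine h2.mono ?_
    rw [norm_mul, mul_comm]
    gcongr
    · exact PiLp.norm_apply_le ξ i
    · exact PiLp.norm_apply_le η j
  refine h1.mono (le_of_eq ?_)
  simp only [Finset.sum_const, Finset.card_univ, Fintype.card_fin, nsmul_eq_mul]
  ring

theorem bddLip_tform (h : GoodCoeff lam0 M0 a) (hlam : 0 < lam0) {k : ℝ} (hk1 : 1 ≤ k)
    (hk : lam0⁻¹ ≤ k) (hM : M0 ≤ k) (ξ : Em m) :
    BddLip (2 * m * k ^ 4 * ‖ξ‖) (tform a ξ) := by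
  have h1 : BddLip (∑ _j : Fin m, k * ‖ξ‖)
      (fun y => ∑ j : Fin m, a y (Fin.last m) j.castSucc * ξ j) := by
    refine BddLip.sum _ fun j _ => ?_
    have h2 := (h.bddLip_entry hlam hk hM (Fin.last m) j.castSucc).const_mul (ξ j)
    simp_rw [mul_comm _ (ξ j)]
    refine h2.mono ?_
    rw [mul_comm]
    gcongr
    exact PiLp.norm_apply_le ξ j
  refine (h1.mul (h.bddLip_ann_inv hlam hk1 hk hM)).mono (le_of_eq ?_)
  simp only [Finset.sum_const, Finset.card_univ, Fintype.card_fin, nsmul_eq_mul]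
  ring

end GoodCoeff

theorem ann_mul_zetafun {a : ℝ → Matrix (Fin (m + 1)) (Fin (m + 1)) ℝ} {ξ γ : Em m} {τ s y : ℝ}
    (h : ann a y ≠ 0) : (ann a y : ℂ) * zetafun a ξ γ τ s y =
      (Bform a ξ ξ y : ℂ) + 2 * Complex.I * ((s * τ : ℝ) : ℂ) * (Bform a ξ γ y : ℂ) -
        ((s * τ : ℝ) : ℂ) ^ 2 * (Bform a γ γ y : ℂ) := by
  have h' : (ann a y : ℂ) ≠ 0 := by exact_mod_cast h
  rw [zetafun, mul_inv_cancel_left₀ h']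

/-- The constant in `CoeffBounds` and `RootBounds` produced from the ellipticity and
Lipschitz constants. -/
def coeffConst (m : ℕ) (M0 lam1 : ℝ) : ℝ := 80 * m ^ 2 * (max lam1⁻¹ M0) ^ 10

section

variable {lam0 M0 lam1 τ s : ℝ} {a : ℝ → Matrix (Fin (m + 1)) (Fin (m + 1)) ℝ} {ξ γ : Em m}

theorem Lam_sq (ξ : Em m) (τ : ℝ) : Lam ξ τ ^ 2 = ‖ξ‖ ^ 2 + τ ^ 2 :=
  Real.sq_sqrt (by positivity)

theorem norm_le_Lam (ξ : Em m) (τ : ℝ) : ‖ξ‖ ≤ Lam ξ τ :=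
  Real.le_sqrt_of_sq_le (by nlinarith [sq_nonneg τ])

theorem le_Lam (ξ : Em m) (τ : ℝ) : τ ≤ Lam ξ τ :=
  Real.le_sqrt_of_sq_le (by nlinarith [sq_nonneg ‖ξ‖])

theorem GoodCoeff.bddLip_symbol (h : GoodCoeff lam0 M0 a) (hlam : 0 < lam0) {k : ℝ}
    (hk1 : 1 ≤ k) (hk : lam0⁻¹ ≤ k) (hM : M0 ≤ k) (hγ : ‖γ‖ ≤ 1) (hτ : 0 ≤ τ) (hs : 0 ≤ s)
    (hs1 : s ≤ 1) :
    BddLip (20 * m ^ 2 * k ^ 5 * Lam ξ τ ^ 2)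
      (fun y => (ann a y : ℂ) * zetafun a ξ γ τ s y) := by
  have hB := fun ξ η => (h.bddLip_Bform hlam hk1 hk hM ξ η).ofReal
  have h1 := ((hB ξ ξ).add ((hB ξ γ).const_mul (2 * Complex.I * ((s * τ : ℝ) : ℂ)))).add
    ((hB γ γ).const_mul (-((s * τ : ℝ) : ℂ) ^ 2))
  have h2 : (fun y => (ann a y : ℂ) * zetafun a ξ γ τ s y) = fun y =>
      (Bform a ξ ξ y : ℂ) + 2 * Complex.I * ((s * τ : ℝ) : ℂ) * (Bform a ξ γ y : ℂ) +
        -((s * τ : ℝ) : ℂ) ^ 2 * (Bform a γ γ y : ℂ) := by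
    funext y
    rw [ann_mul_zetafun (hlam.trans_le (h.le_ann y)).ne']
    ring
  rw [h2]
  refine h1.mono ?_
  have hsτ : 0 ≤ s * τ := mul_nonneg hs hτ
  rw [norm_mul, norm_mul, norm_neg, norm_pow, Complex.norm_real, Real.norm_of_nonneg hsτ,
    Complex.norm_I, Complex.norm_ofNat]
  have hΛ : 0 ≤ Lam ξ τ := Real.sqrt_nonneg _
  have h3 : s * τ * ‖γ‖ ≤ Lam ξ τ := by
    calc s * τ * ‖γ‖ ≤ 1 * τ * 1 := by gcongr
      _ = τ := by ring
      _ ≤ _ := le_Lam ξ τ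
  have h4 : (‖ξ‖ + s * τ * ‖γ‖) ^ 2 ≤ (2 * Lam ξ τ) ^ 2 := by
    gcongr
    linarith [norm_le_Lam ξ τ]
  have h5 : 0 ≤ 5 * (m : ℝ) ^ 2 * k ^ 5 := by positivity
  calc _ = 5 * (m : ℝ) ^ 2 * k ^ 5 * (‖ξ‖ + s * τ * ‖γ‖) ^ 2 := by ring
    _ ≤ 5 * (m : ℝ) ^ 2 * k ^ 5 * (2 * Lam ξ τ) ^ 2 := by gcongr
    _ = _ := by ring

theorem coeffConst_bounds (hm : 1 ≤ m) (hlam1 : 0 < lam1) (hlam1' : lam1 ≤ 1) {k : ℝ}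
    (hk : k = max lam1⁻¹ M0) : 1 ≤ k ∧ lam1⁻¹ ≤ k ∧ M0 ≤ k ∧
      ∀ c : ℝ, ∀ i j : ℕ, c ≤ 80 → i ≤ 2 → j ≤ 10 →
        c * (m : ℝ) ^ i * k ^ j ≤ coeffConst m M0 lam1 := by
  have h1 : lam1⁻¹ ≤ k := hk ▸ le_max_left _ _
  have hk1 : 1 ≤ k := ((one_le_inv₀ hlam1).mpr hlam1').trans h1
  have hm' : (1 : ℝ) ≤ m := by exact_mod_cast hm
  refine ⟨hk1, h1, hk ▸ le_max_right _ _, fun c i j hc hi hj => ?_⟩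
  rw [coeffConst, ← hk]
  gcongr

theorem GoodCoeff.coeffBounds (h : GoodCoeff lam0 M0 a) (hm : 1 ≤ m) (hlam0 : lam0 ≤ 1)
    (hlam1 : 0 < lam1) (hlam1' : lam1 ≤ lam0)
    (hγ : ‖γ‖ ≤ 1) (hτ : 0 ≤ τ) (hs : 0 ≤ s) (hs1 : s ≤ 1) :
    CoeffBounds (coeffConst m M0 lam1) (Lam ξ τ) a ξ γ τ s := by
  have hlam : 0 < lam0 := hlam1.trans_le hlam1'
  obtain ⟨hk1, hk, hM, hK⟩ := coeffConst_bounds (M0 := M0) hm hlam1 (hlam1'.trans hlam0) rfl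
  set k := max lam1⁻¹ M0
  have hk0 : lam0⁻¹ ≤ k := (inv_anti₀ hlam1 hlam1').trans hk
  have hkK : k ≤ coeffConst m M0 lam1 := by
    simpa using hK 1 0 1 (by norm_num) (by norm_num) (by norm_num)
  have hΛ : 0 ≤ Lam ξ τ := Real.sqrt_nonneg _
  have h4 : 2 * (m : ℝ) * k ^ 4 ≤ coeffConst m M0 lam1 := by
    simpa using hK 2 1 4 (by norm_num) (by norm_num) (by norm_num)
  have hpos : ∀ y, 0 < _root_.ann a y := fun y => hlam.trans_le (h.le_ann y)
  refine ⟨hpos, fun y => ((inv_anti₀ hlam (h.le_ann y)).trans hk0).trans hkK,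
    (h.bddLip_entry hlam hk0 hM _ _).mono hkK, (h.bddLip_tform hlam hk1 hk0 hM ξ).mono ?_,
    (h.bddLip_tform hlam hk1 hk0 hM γ).mono ?_,
    (h.bddLip_symbol hlam hk1 hk0 hM hγ hτ hs hs1).mono ?_⟩
  · have := norm_le_Lam ξ τ
    have hK0 : 0 ≤ coeffConst m M0 lam1 := by linarith
    gcongr
  · refine le_trans (mul_le_of_le_one_right (by positivity) hγ) h4
  · have := hK 20 2 5 (by norm_num) (by norm_num) (by norm_num)
    gcongr

theorem GoodCoeff.exists_rootBounds (h : GoodCoeff lam0 M0 a) (hB : GoodB lam1 a) (hm : 1 ≤ m)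
    (hlam0 : lam0 ≤ 1) (hlam1 : 0 < lam1) (hlam1' : lam1 ≤ lam0)
    (hγ : ‖γ‖ ≤ 1) (hτ : 0 < τ) (hs : 0 ≤ s) (hs1 : s ≤ lam1 / 2) (hreg : 2 * τ ≤ Lam ξ τ) :
    ∃ p, RootBounds (coeffConst m M0 lam1) (Lam ξ τ) a ξ γ τ s p := by
  have hlam : 0 < lam0 := hlam1.trans_le hlam1'
  obtain ⟨hk1, hk, hM, hK⟩ := coeffConst_bounds (M0 := M0) hm hlam1 (hlam1'.trans hlam0) rfl
  set k := max lam1⁻¹ M0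
  have hk0 : lam0⁻¹ ≤ k := (inv_anti₀ hlam1 hlam1').trans hk
  have hm' : (1 : ℝ) ≤ m := by exact_mod_cast hm
  have hΛ : 0 < Lam ξ τ := hτ.trans_le (le_Lam ξ τ)
  have hpos : ∀ y, 0 < ann a y := fun y => hlam.trans_le (h.le_ann y)
  have hann : BddLip k (ann a) := h.bddLip_entry hlam hk0 hM _ _
  have hG : BddLip (40 * m ^ 2 * k ^ 6 * Lam ξ τ ^ 2)
      (fun y => (ann a y : ℂ) * ((ann a y : ℂ) * zetafun a ξ γ τ s y)) := by
    refine (hann.ofReal.mul (h.bddLip_symbol hlam hk1 hk0 hM hγ hτ.le hs (by linarith))).mono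
      (le_of_eq ?_)
    ring
  have hkk : k⁻¹ ≤ lam1 := by rw [inv_le_comm₀ (by linarith) hlam1]; exact hk
  have hre : ∀ y, Lam ξ τ ^ 2 / (4 * k ^ 2) ≤
      ((ann a y : ℂ) * ((ann a y : ℂ) * zetafun a ξ γ τ s y)).re := fun y => by
    rw [Complex.re_ofReal_mul, ann_mul_zetafun (hpos y).ne']
    have h1 : ((Bform a ξ ξ y : ℂ) + 2 * Complex.I * ((s * τ : ℝ) : ℂ) * (Bform a ξ γ y : ℂ) -
        ((s * τ : ℝ) : ℂ) ^ 2 * (Bform a γ γ y : ℂ)).re =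
        Bform a ξ ξ y - (s * τ) ^ 2 * Bform a γ γ y := by
      rw [← Complex.ofReal_pow, Complex.sub_re, Complex.re_ofReal_mul, Complex.add_re,
        Complex.ofReal_re, Complex.ofReal_re]
      simp
    rw [h1]
    have h2 := (hB ξ y).1
    have h3 : Bform a γ γ y ≤ lam1⁻¹ := (hB γ y).2.trans
      (mul_le_of_le_one_right (inv_pos.mpr hlam1).le (pow_le_one₀ (norm_nonneg _) hγ))
    have h0 : 0 ≤ Bform a γ γ y := le_trans (by positivity) (hB γ y).1
    have h4 : (s * τ) ^ 2 * Bform a γ γ y ≤ lam1 / 4 * τ ^ 2 := by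
      calc (s * τ) ^ 2 * Bform a γ γ y ≤ (lam1 / 2 * τ) ^ 2 * lam1⁻¹ := by gcongr
        _ = lam1 / 4 * τ ^ 2 := by field_simp; norm_num
    have h5 := Lam_sq ξ τ
    have h6 : 4 * τ ^ 2 ≤ Lam ξ τ ^ 2 := by nlinarith
    have h7 : lam1 * (Lam ξ τ ^ 2 / 4) ≤ Bform a ξ ξ y - (s * τ) ^ 2 * Bform a γ γ y := by
      nlinarith
    have h8 : k⁻¹ * (Lam ξ τ ^ 2 / 4) ≤ lam1 * (Lam ξ τ ^ 2 / 4) := by gcongr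
    have h9 : k⁻¹ ≤ ann a y := (hkk.trans hlam1').trans (h.le_ann y)
    calc Lam ξ τ ^ 2 / (4 * k ^ 2) = k⁻¹ * (k⁻¹ * (Lam ξ τ ^ 2 / 4)) := by field_simp
      _ ≤ ann a y * (Bform a ξ ξ y - (s * τ) ^ 2 * Bform a γ γ y) :=
        mul_le_mul h9 (h8.trans h7) (by positivity) (hpos y).le
  have hQ : (1 : ℝ) ≤ 40 * m ^ 2 * k ^ 6 := by
    nlinarith [one_le_mul_of_one_le_of_one_le (one_le_pow₀ hm' (n := 2))
      (one_le_pow₀ hk1 (n := 6))]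
  obtain ⟨p, hp, hlow, hlip⟩ := BddLip.exists_sqrt hΛ hQ hk1 hG hre
  have hK0 : k ≤ coeffConst m M0 lam1 := by
    simpa using hK 1 0 1 (by norm_num) (by norm_num) (by norm_num)
  have hK1 : 2 * k ≤ coeffConst m M0 lam1 := by
    simpa using hK 2 0 1 (by norm_num) (by norm_num) (by norm_num)
  have hK2 : 2 * k ^ 2 ≤ coeffConst m M0 lam1 := by
    simpa using hK 2 0 2 (by norm_num) (by norm_num) (by norm_num)
  have hinv := h.bddLip_ann_inv hlam hk1 hk0 hM
  refine ⟨p, hp, hlip.mono ?_, fun y => le_trans ?_ (hlow y), (hlip.re.mul hinv).mono ?_,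
    fun y => ?_⟩
  · have := hK 40 2 7 (by norm_num) (by norm_num) (by norm_num)
    calc k * (40 * m ^ 2 * k ^ 6) * Lam ξ τ = 40 * m ^ 2 * k ^ 7 * Lam ξ τ := by ring
      _ ≤ _ := by gcongr
  · gcongr
  · have := hK 80 2 10 (by norm_num) (by norm_num) (by norm_num)
    calc 2 * (k * (40 * m ^ 2 * k ^ 6) * Lam ξ τ) * k ^ 3 =
          80 * m ^ 2 * k ^ 10 * Lam ξ τ := by ring
      _ ≤ _ := by gcongr
  · have h1 : k⁻¹ ≤ (ann a y)⁻¹ := inv_anti₀ (hpos y) ((le_abs_self _).trans (hann.1 y))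
    calc Lam ξ τ / coeffConst m M0 lam1 ≤ Lam ξ τ / (2 * k ^ 2) := by gcongr
      _ = Lam ξ τ / (2 * k) * k⁻¹ := by field_simp
      _ ≤ (p y).re * (ann a y)⁻¹ := by
        have := hlow y
        have h0 : 0 ≤ (p y).re := le_trans (by positivity) this
        gcongr
      _ = _ := by rw [div_eq_mul_inv]

theorem Lconst_le {ap am : ℝ → Matrix (Fin (m + 1)) (Fin (m + 1)) ℝ}
    (hp : GoodCoeff lam0 M0 ap) (hn : GoodCoeff lam0 M0 am) (hBp : GoodB lam1 ap)
    (hBm : GoodB lam1 am) (hm : 1 ≤ m) (hlam0 : lam0 ≤ 1) (hlam1 : 0 < lam1)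
    (hlam1' : lam1 ≤ lam0) : Lconst ap am ≤ coeffConst m M0 lam1 := by
  have hlam : 0 < lam0 := hlam1.trans_le hlam1'
  obtain ⟨hk1, hk, hM, hK⟩ := coeffConst_bounds (M0 := M0) hm hlam1 (hlam1'.trans hlam0) rfl
  set k := max lam1⁻¹ M0
  have hk0 : lam0⁻¹ ≤ k := (inv_anti₀ hlam1 hlam1').trans hk
  have hkk : k⁻¹ ≤ lam1 := by rw [inv_le_comm₀ (by linarith) hlam1]; exact hk
  have hkK : k ^ 2 ≤ coeffConst m M0 lam1 := by
    simpa using hK 1 0 2 (by norm_num) (by norm_num) (by norm_num)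
  refine le_trans (Real.iSup_le (fun ξ => ?_) (by positivity)) hkK
  have hξ : 0 < ‖ξ.1‖ := norm_pos_iff.mpr ξ.2
  have hpos : 0 < ann ap 0 := hlam.trans_le (hp.le_ann 0)
  have hposm : 0 < ann am 0 := hlam.trans_le (hn.le_ann 0)
  have h1 : mfun ap ξ.1 0 ≤ k * ‖ξ.1‖ := by
    refine Real.sqrt_le_iff.mpr ⟨by positivity, ?_⟩
    have h2 : (ann ap 0)⁻¹ ≤ k := (inv_anti₀ hlam (hp.le_ann 0)).trans hk0
    have h3 : Bform ap ξ.1 ξ.1 0 ≤ k * ‖ξ.1‖ ^ 2 := (hBp ξ.1 0).2.trans (by gcongr)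
    calc Bform ap ξ.1 ξ.1 0 / ann ap 0 ≤ k * ‖ξ.1‖ ^ 2 * k := by
          rw [div_eq_mul_inv]; gcongr
      _ = _ := by ring
  have h2 : k⁻¹ * ‖ξ.1‖ ≤ mfun am ξ.1 0 := by
    refine Real.le_sqrt_of_sq_le ?_
    have h3 : ann am 0 ≤ k := (le_abs_self _).trans ((hn.bddLip_entry hlam hk0 hM _ _).1 0)
    have h4 : k⁻¹ * ‖ξ.1‖ ^ 2 ≤ Bform am ξ.1 ξ.1 0 := le_trans (by gcongr) (hBm ξ.1 0).1
    rw [le_div_iff₀ hposm]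
    calc (k⁻¹ * ‖ξ.1‖) ^ 2 * ann am 0 ≤ (k⁻¹ * ‖ξ.1‖) ^ 2 * k := by gcongr
      _ = k⁻¹ * ‖ξ.1‖ ^ 2 := by field_simp
      _ ≤ _ := h4
  have h3 : 0 < k⁻¹ * ‖ξ.1‖ := by positivity
  rw [div_le_iff₀ (h3.trans_le h2)]
  calc mfun ap ξ.1 0 ≤ k * ‖ξ.1‖ := h1
    _ = k ^ 2 * (k⁻¹ * ‖ξ.1‖) := by field_simp
    _ ≤ _ := by gcongr

end

theorem ContDiff.deriv_top {v : ℝ → ℂ} (hv : ContDiff ℝ (⊤ : ℕ∞) v) :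
    ContDiff ℝ (⊤ : ℕ∞) (deriv v) :=
  hv.iterate_deriv 1

namespace CoeffBounds

variable {K Λ τ s α β hi c d : ℝ} {a : ℝ → Matrix (Fin (m + 1)) (Fin (m + 1)) ℝ} {ξ γ : Em m}
  {v : ℝ → ℂ} {p : ℝ → ℂ}

theorem exists_bddLip_Pinner (H : CoeffBounds K Λ a ξ γ τ s) (hv : ContDiff ℝ (⊤ : ℕ∞) v)
    (hc : HasCompactSupport v) : ∃ C, BddLip C (Pinner a ξ γ τ s α β v) := by
  obtain ⟨C₀, h₀⟩ := BddLip.exists_of_contDiff (hv.of_le (by exact_mod_cast le_top)) hc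
  obtain ⟨C₁, h₁⟩ := BddLip.exists_of_contDiff (hv.deriv_top.of_le (by exact_mod_cast le_top))
    hc.deriv
  have hyv : ContDiff ℝ 1 (fun y : ℝ => (y : ℂ) * v y) :=
    Complex.ofRealCLM.contDiff.mul (hv.of_le (by exact_mod_cast le_top))
  obtain ⟨C₂, h₂⟩ := BddLip.exists_of_contDiff hyv hc.mul_left
  have h := H.ann.ofReal.mul ((((h₁.add ((H.tform_xi.ofReal.mul h₀).const_mul Complex.I)).add
    ((H.tform_gamma.ofReal.mul h₀).const_mul (-((τ * s : ℝ) : ℂ)))).add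
      (h₀.const_mul (-((τ * α : ℝ) : ℂ)))).add (h₂.const_mul (-((τ * β : ℝ) : ℂ))))
  have he : Pinner a ξ γ τ s α β v = fun y => (_root_.ann a y : ℂ) *
      (deriv v y + Complex.I * ((tform a ξ y : ℂ) * v y) +
        -((τ * s : ℝ) : ℂ) * ((tform a γ y : ℂ) * v y) + -((τ * α : ℝ) : ℂ) * v y +
        -((τ * β : ℝ) : ℂ) * ((y : ℂ) * v y)) := by
    funext y
    simp only [Pinner, tC]
    push_cast
    linear_combination (_root_.ann a y * (τ * s) * tform a γ y * v y : ℂ) * Complex.I_mul_I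
  rw [he]
  exact ⟨_, h⟩

theorem fluxSystem (H : CoeffBounds K Λ a ξ γ τ s) (hK : 1 ≤ K) (hτ : 1 ≤ τ) (hτΛ : τ ≤ Λ)
    (hs0 : 0 ≤ s) (hs1 : s ≤ 1) (hα : 4 * K ≤ α) (hhi : α + 1 + K ≤ hi) (hβ : K ≤ β)
    (hcd : c ≤ d) (hc : -1 ≤ β * c) (hd : β * d ≤ 1)
    (hv : ContDiff ℝ (⊤ : ℕ∞) v) (hcs : HasCompactSupport v) :
    FluxSystem K Λ τ β (α / 2) hi c d (_root_.ann a) (tform a ξ)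
      (fun y => α + β * y + s * tform a γ y)
      (fun y => (_root_.ann a y : ℂ) * zetafun a ξ γ τ s y) v (Pinner a ξ γ τ s α β v)
      (Pop a ξ γ τ s α β v) := by
  obtain ⟨C, hu⟩ := H.exists_bddLip_Pinner (α := α) (β := β) hv hcs
  have hβ0 : 0 ≤ β := by linarith
  have htγ : ∀ y, |s * tform a γ y| ≤ K := fun y => by
    rw [abs_mul, abs_of_nonneg hs0]
    calc s * |tform a γ y| ≤ 1 * K := mul_le_mul hs1 (H.tform_gamma.1 y) (abs_nonneg _) zero_le_one
      _ = K := one_mul K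
  have hne : ∀ y, (_root_.ann a y : ℂ) ≠ 0 := fun y => by exact_mod_cast (H.ann_pos y).ne'
  have hvd : ∀ y, HasDerivAt v (deriv v y) y := fun y =>
    (hv.differentiable (by simp) y).hasDerivAt
  refine
    { le := hcd, one_le_K := hK, one_le_tau := hτ, tau_le := hτΛ, K_le_beta := hβ,
      one_le_lo := by linarith, lo_le := fun y hy => ?_, le_hi := fun y hy => ?_,
      A_pos := H.ann_pos, inv_le := H.inv_le, Z_le := H.symbol.1, ac_psi := ?_, ac_v := ?_,
      ac_u := hu.absolutelyContinuousOnInterval c d, int_f := ?_, deriv_v := fun y => ?_,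
      deriv_u := ?_, deriv_psi := ?_ }
  · have h1 := (abs_le.mp (htγ y)).1
    have h2 : β * c ≤ β * y := by gcongr; exact hy.1
    linarith
  · have h1 := (abs_le.mp (htγ y)).2
    have h2 : β * y ≤ β * d := by gcongr; exact hy.2
    linarith
  · have h1 : AbsolutelyContinuousOnInterval (fun y : ℝ => α + β * y) c d :=
      ContDiffOn.absolutelyContinuousOnInterval (by fun_prop)
    exact h1.add ((H.tform_gamma.const_mul s).absolutelyContinuousOnInterval c d)
  · exact ContDiffOn.absolutelyContinuousOnInterval
      (hv.of_le (by exact_mod_cast le_top)).contDiffOn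
  · have hcont : Continuous fun y => (Complex.I * tC a ξ γ τ s y -
        ((τ * (α + β * y) : ℝ) : ℂ)) * Pinner a ξ γ τ s α β v y -
        (_root_.ann a y : ℂ) * zetafun a ξ γ τ s y * v y := by
      have h1 := H.tform_xi.ofReal.continuous
      have h2 := H.tform_gamma.ofReal.continuous
      have h3 := H.symbol.continuous
      have h4 := hu.continuous
      have h5 := hv.continuous
      have h6 : Continuous (tC a ξ γ τ s) := by
        unfold tC
        exact h1.add (continuous_const.mul h2)
      have h7 : Continuous fun y : ℝ => ((τ * (α + β * y) : ℝ) : ℂ) :=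
        Complex.continuous_ofReal.comp (by fun_prop)
      exact (((continuous_const.mul h6).sub h7).mul h4).sub (h3.mul h5)
    obtain ⟨D, hD⟩ := isCompact_uIcc.exists_bound_of_continuousOn
      (s := Set.uIcc c d) hcont.continuousOn
    have hmeas : AEStronglyMeasurable (fun y => ‖Pop a ξ γ τ s α β v y‖ ^ 2) volume := by
      have h1 : Measurable (Pop a ξ γ τ s α β v) := by
        have : Pop a ξ γ τ s α β v = fun y => deriv (Pinner a ξ γ τ s α β v) y +
            ((Complex.I * tC a ξ γ τ s y - ((τ * (α + β * y) : ℝ) : ℂ)) *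
              Pinner a ξ γ τ s α β v y - (_root_.ann a y : ℂ) * zetafun a ξ γ τ s y * v y) := by
          funext y; rw [Pop, add_sub_assoc]
        rw [this]
        exact (measurable_deriv _).add hcont.measurable
      exact (h1.norm.pow_const 2).aestronglyMeasurable
    rw [intervalIntegrable_iff]
    refine Measure.integrableOn_of_bounded (M := (C + D) ^ 2) ?_ hmeas ?_
    · rw [Set.uIoc]; exact measure_Ioc_lt_top.ne
    · refine (ae_restrict_mem measurableSet_uIoc).mono fun y hy => ?_
      rw [norm_pow, norm_norm]
      gcongr
      rw [Pop, add_sub_assoc]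
      exact (norm_add_le _ _).trans (add_le_add (hu.norm_deriv_le y)
        (hD y (Set.uIoc_subset_uIcc hy)))
  · convert hvd y using 1
    rw [Pinner, mul_div_cancel_left₀ _ (hne y), tC]
    push_cast
    linear_combination (τ * s * tform a γ y * v y : ℂ) * Complex.I_mul_I
  · filter_upwards [hu.ae_hasDerivAt] with y ⟨e, he, _⟩ _
    have h1 : e = ((τ * (α + β * y + s * tform a γ y) : ℝ) - tform a ξ y * Complex.I) *
        Pinner a ξ γ τ s α β v y + (_root_.ann a y : ℂ) * zetafun a ξ γ τ s y * v y +
        Pop a ξ γ τ s α β v y := by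
      simp only [Pop, he.deriv, tC]
      push_cast
      linear_combination (-τ * s * tform a γ y * Pinner a ξ γ τ s α β v y : ℂ) * Complex.I_mul_I
    rw [h1] at he
    exact he
  · filter_upwards [H.tform_gamma.ae_hasDerivAt] with y ⟨e, he, he'⟩ _
    refine ⟨_, ((((hasDerivAt_id y).const_mul β).const_add α).add (he.const_mul s)), ?_⟩
    have h1 : |s * e| ≤ K := by
      rw [abs_mul, abs_of_nonneg hs0]
      calc s * |e| ≤ 1 * K := mul_le_mul hs1 he' (abs_nonneg _) zero_le_one
        _ = K := one_mul K
    have := (abs_le.mp h1).1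
    linarith

theorem ae_regular (H : CoeffBounds K Λ a ξ γ τ s) (hs0 : 0 ≤ s) (hs1 : s ≤ 1) (hβ : 0 ≤ β) :
    ∀ᵐ y, y ∈ Set.Ioo c d → ∃ dψ dT dA,
      HasDerivAt (fun y => α + β * y + s * tform a γ y) dψ y ∧ HasDerivAt (tform a ξ) dT y ∧
      HasDerivAt (_root_.ann a) dA y ∧ |dψ| ≤ β + K ∧ |dT| ≤ K * Λ ∧ |dA| ≤ K := by
  filter_upwards [H.tform_gamma.ae_hasDerivAt, H.tform_xi.ae_hasDerivAt, H.ann.ae_hasDerivAt]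
    with y ⟨e, he, he'⟩ ⟨t, ht, ht'⟩ ⟨A, hA, hA'⟩ _
  refine ⟨_, t, A, ((((hasDerivAt_id y).const_mul β).const_add α).add (he.const_mul s)), ht, hA,
    ?_, ht', hA'⟩
  have h1 : |s * e| ≤ K := by
    rw [abs_mul, abs_of_nonneg hs0]
    calc s * |e| ≤ 1 * K := mul_le_mul hs1 he' (abs_nonneg _) zero_le_one
      _ = K := one_mul K
  refine (abs_add_le _ _).trans ?_
  rw [mul_one, abs_of_nonneg hβ]
  linarith

end CoeffBounds

theorem RootBounds.fluxRoot {K Λ τ s c d : ℝ} {a : ℝ → Matrix (Fin (m + 1)) (Fin (m + 1)) ℝ}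
    {ξ γ : Em m} {p : ℝ → ℂ} (R : RootBounds K Λ a ξ γ τ s p) :
    FluxRoot K Λ c d (ann a) (fun y => (ann a y : ℂ) * zetafun a ξ γ τ s y) p where
  sq_eq := R.sq_eq
  norm_le := R.bddLip.1
  le_norm := R.le_re
  le_re := R.le_div
  re_le y := (le_abs_self _).trans (R.bddLip_div.1 y)
  ac := R.bddLip.absolutelyContinuousOnInterval c d
  ac_re := R.bddLip_div.absolutelyContinuousOnInterval c d
  deriv := R.bddLip.ae_hasDerivAt
  deriv_re := R.bddLip_div.ae_hasDerivAt

section Support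

variable {ρ : ℝ}

theorem L2p_eq_intervalIntegral {g : ℝ → ℂ} (hρ : 0 ≤ ρ)
    (hg : Function.support g ⊆ Set.Icc (-ρ) ρ) : L2p g = ∫ y in (0 : ℝ)..ρ, ‖g y‖ ^ 2 := by
  rw [L2p, intervalIntegral.integral_of_le hρ]
  refine setIntegral_eq_of_subset_of_forall_sdiff_eq_zero measurableSet_Ioi
    Set.Ioc_subset_Ioi_self fun y hy => ?_
  have : g y = 0 := by
    by_contra h
    exact hy.2 ⟨hy.1, (hg h).2⟩
  rw [this]; simp

theorem L2m_eq_intervalIntegral {g : ℝ → ℂ} (hρ : 0 ≤ ρ)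
    (hg : Function.support g ⊆ Set.Icc (-ρ) ρ) : L2m g = ∫ y in (-ρ)..0, ‖g y‖ ^ 2 := by
  rw [L2m, ← integral_Iic_eq_integral_Iio, intervalIntegral.integral_of_le (by linarith),
    integral_Iic_eq_integral_Iio, integral_Ioc_eq_integral_Ioo, ← integral_Ico_eq_integral_Ioo]
  refine setIntegral_eq_of_subset_of_forall_sdiff_eq_zero measurableSet_Iio
    Set.Ico_subset_Iio_self fun y hy => ?_
  have : g y = 0 := by
    by_contra h
    exact hy.2 ⟨(hg h).1, hy.1⟩
  rw [this]; simp

theorem support_deriv_subset_Icc {g : ℝ → ℂ} (hg : Function.support g ⊆ Set.Icc (-ρ) ρ) :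
    Function.support (deriv g) ⊆ Set.Icc (-ρ) ρ :=
  (support_deriv_subset).trans (closure_minimal hg isClosed_Icc)

theorem eq_zero_of_support_subset_Icc {g : ℝ → ℂ} (hc : Continuous g)
    (hg : Function.support g ⊆ Set.Icc (-ρ) ρ) : g (-ρ) = 0 ∧ g ρ = 0 := by
  have h : Function.support g ⊆ Set.Ioo (-ρ) ρ := by
    rw [← interior_Icc]
    exact interior_maximal hg hc.isOpen_support
  constructor <;> by_contra h0
  · exact lt_irrefl _ (h h0).1
  · exact lt_irrefl _ (h h0).2

variable {τ s α β : ℝ} {a : ℝ → Matrix (Fin (m + 1)) (Fin (m + 1)) ℝ} {ξ γ : Em m} {v : ℝ → ℂ}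

theorem support_Pinner_subset (hg : Function.support v ⊆ Set.Icc (-ρ) ρ) :
    Function.support (Pinner a ξ γ τ s α β v) ⊆ Set.Icc (-ρ) ρ := by
  intro y hy
  by_contra h
  have h1 : v y = 0 := by by_contra h0; exact h (hg h0)
  have h2 : deriv v y = 0 := by by_contra h0; exact h (support_deriv_subset_Icc hg h0)
  exact hy (by rw [Pinner, h1, h2]; ring)

theorem support_Pop_subset (hg : Function.support v ⊆ Set.Icc (-ρ) ρ) :
    Function.support (Pop a ξ γ τ s α β v) ⊆ Set.Icc (-ρ) ρ := by
  intro y hy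
  by_contra h
  have h1 : v y = 0 := by by_contra h0; exact h (hg h0)
  have h2 : Pinner a ξ γ τ s α β v y = 0 := by
    by_contra h0; exact h (support_Pinner_subset hg h0)
  have h3 : deriv (Pinner a ξ γ τ s α β v) y = 0 := by
    by_contra h0; exact h (support_deriv_subset_Icc (support_Pinner_subset hg) h0)
  exact hy (by rw [Pop, h1, h2, h3]; ring)

theorem Pinner_zero : Pinner a ξ γ τ s α β v 0 = Vval a ξ γ τ s α v := by
  rw [Pinner, Vval]
  push_cast
  ring

end Support

/-- The constant in the interior estimates for `FluxSystem`. -/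
def bulkConst (K hi : ℝ) : ℝ := (4 * hi * K) ^ 2 * K ^ 2 * (4 + 2 * K ^ 2 * (hi + K))

namespace FluxSystem

variable {K Λ τ β lo hi a b : ℝ} {A T ψ : ℝ → ℝ} {Z v u f p : ℝ → ℂ}

theorem le_bulkConst (hK : 1 ≤ K) (hhi : 1 ≤ hi) : 1 ≤ bulkConst K hi ∧ hi ≤ bulkConst K hi ∧
    (4 * hi * K) ^ 2 * K ^ 2 * 4 ≤ bulkConst K hi ∧
    (4 * hi * K) ^ 2 * K ^ 2 * (2 * K ^ 2 * (hi + K)) ≤ bulkConst K hi := by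
  have h1 : 1 ≤ (4 * hi * K) ^ 2 * K ^ 2 := by
    have : 1 ≤ 4 * hi * K := by nlinarith
    exact one_le_mul_of_one_le_of_one_le (one_le_pow₀ this) (one_le_pow₀ hK)
  have h2 : hi ≤ 2 * K ^ 2 * (hi + K) := by nlinarith [one_le_pow₀ hK (n := 2)]
  unfold bulkConst
  refine ⟨?_, ?_, ?_, ?_⟩ <;> nlinarith

theorem integral_nonneg (S : FluxSystem K Λ τ β lo hi a b A T ψ Z v u f) (w : ℝ → ℂ) :
    0 ≤ ∫ y in a..b, ‖w y‖ ^ 2 :=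
  intervalIntegral.integral_nonneg S.le fun _ _ => by positivity

theorem div_tau_mul_le (hK : 1 ≤ K) (hτ : 1 ≤ τ) {J : ℝ} (hJ : 0 ≤ J) :
    Λ ^ 2 / τ * J ≤ K ^ 2 * Λ ^ 2 * J := by
  have h1 : Λ ^ 2 / τ ≤ Λ ^ 2 := div_le_self (sq_nonneg Λ) hτ
  have h2 : Λ ^ 2 ≤ K ^ 2 * Λ ^ 2 := le_mul_of_one_le_left (sq_nonneg Λ) (one_le_pow₀ hK)
  exact mul_le_mul_of_nonneg_right (h1.trans h2) hJ

theorem bulk_left_of_dominant (S : FluxSystem K Λ τ β lo hi a b A T ψ Z v u f)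
    (hv : v b = 0) (hu : u b = 0) (hdom : 4 * K ^ 2 * Λ ^ 2 ≤ lo ^ 2 * τ ^ 2) :
    Λ ^ 2 / τ * (Λ ^ 2 * (∫ y in a..b, ‖v y‖ ^ 2) + ∫ y in a..b, ‖u y‖ ^ 2) ≤
        (∫ y in a..b, ‖f y‖ ^ 2) ∧
      lo * τ * (Λ ^ 2 * ‖v a‖ ^ 2 + ‖u a‖ ^ 2) ≤ 2 * ∫ y in a..b, ‖f y‖ ^ 2 := by
  have e := S.energy_of_dominant hdom
  have hJ : 0 ≤ Λ ^ 2 * (∫ y in a..b, ‖v y‖ ^ 2) + ∫ y in a..b, ‖u y‖ ^ 2 := by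
    have := S.integral_nonneg v
    have := S.integral_nonneg u
    positivity
  have hτ := S.one_le_tau
  have h1 := div_tau_mul_le (Λ := Λ) S.one_le_K hτ hJ
  have hψ := S.lo_le a (Set.left_mem_Icc.mpr S.le)
  have hN : 0 ≤ Λ ^ 2 * ‖v a‖ ^ 2 + ‖u a‖ ^ 2 := by positivity
  have h2 : lo * τ * (Λ ^ 2 * ‖v a‖ ^ 2 + ‖u a‖ ^ 2) ≤
      τ * ψ a * (Λ ^ 2 * ‖v a‖ ^ 2 + ‖u a‖ ^ 2) := by
    rw [mul_comm lo]
    gcongr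
  have h3 : 0 ≤ lo * τ * (Λ ^ 2 * ‖v a‖ ^ 2 + ‖u a‖ ^ 2) := by
    have := S.one_le_lo
    positivity
  have h4 : 0 ≤ K ^ 2 * Λ ^ 2 *
      (Λ ^ 2 * (∫ y in a..b, ‖v y‖ ^ 2) + ∫ y in a..b, ‖u y‖ ^ 2) := by positivity
  simp only [hv, hu, norm_zero, ne_eq, OfNat.ofNat_ne_zero, not_false_eq_true, zero_pow,
    mul_zero, add_zero] at e
  constructor <;> linarith

theorem bulk_right_of_dominant (S : FluxSystem K Λ τ β lo hi a b A T ψ Z v u f)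
    (hv : v a = 0) (hu : u a = 0) (hdom : 4 * K ^ 2 * Λ ^ 2 ≤ lo ^ 2 * τ ^ 2) :
    Λ ^ 2 / τ * (Λ ^ 2 * (∫ y in a..b, ‖v y‖ ^ 2) + ∫ y in a..b, ‖u y‖ ^ 2) ≤
      (∫ y in a..b, ‖f y‖ ^ 2) + hi * (Λ * (Λ ^ 2 * ‖v b‖ ^ 2 + ‖u b‖ ^ 2)) := by
  have e := S.energy_of_dominant hdom
  have hJ : 0 ≤ Λ ^ 2 * (∫ y in a..b, ‖v y‖ ^ 2) + ∫ y in a..b, ‖u y‖ ^ 2 := by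
    have := S.integral_nonneg v
    have := S.integral_nonneg u
    positivity
  have hτ := S.one_le_tau
  have hτΛ := S.tau_le
  have h1 := div_tau_mul_le (Λ := Λ) S.one_le_K hτ hJ
  have hlo := S.lo_le b (Set.right_mem_Icc.mpr S.le)
  have hψ := S.le_hi b (Set.right_mem_Icc.mpr S.le)
  have hN : 0 ≤ Λ ^ 2 * ‖v b‖ ^ 2 + ‖u b‖ ^ 2 := by positivity
  have h2 : τ * ψ b ≤ Λ * hi := by
    have := S.one_le_lo
    exact mul_le_mul hτΛ hψ (by linarith) (by linarith)
  have h3 := mul_le_mul_of_nonneg_right h2 hN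
  have h4 : 0 ≤ hi * (Λ * (Λ ^ 2 * ‖v b‖ ^ 2 + ‖u b‖ ^ 2)) := by
    have := S.one_le_lo
    have : 0 ≤ hi := by linarith
    have : 0 ≤ Λ := by linarith
    positivity
  simp only [hv, hu, norm_zero, ne_eq, OfNat.ofNat_ne_zero, not_false_eq_true, zero_pow,
    mul_zero, add_zero] at e
  linarith

theorem bulk_of_root (S : FluxSystem K Λ τ β lo hi a b A T ψ Z v u f)
    (R : FluxRoot K Λ a b A Z p) (hτ : 8 * K ^ 3 ≤ τ) (hτ' : 4 * K ^ 4 * (4 * hi * K) ^ 2 ≤ τ)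
    (hhi : 1 ≤ hi) (hβ : K + 4 * hi * K ^ 2 + 1 ≤ β) :
    Λ ^ 2 / τ * (Λ ^ 2 * (∫ y in a..b, ‖v y‖ ^ 2) + ∫ y in a..b, ‖u y‖ ^ 2) ≤
      bulkConst K hi * ((∫ y in a..b, ‖f y‖ ^ 2) +
        Λ * ((Λ ^ 2 * ‖v a‖ ^ 2 + ‖u a‖ ^ 2) + (Λ ^ 2 * ‖v b‖ ^ 2 + ‖u b‖ ^ 2))) := by
  obtain ⟨_, _, h1, h2⟩ := le_bulkConst S.one_le_K hhi
  have hΛ : 0 ≤ Λ := by linarith [S.one_le_tau, S.tau_le]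
  have hN : 0 ≤ Λ * ((Λ ^ 2 * ‖v a‖ ^ 2 + ‖u a‖ ^ 2) + (Λ ^ 2 * ‖v b‖ ^ 2 + ‖u b‖ ^ 2)) := by
    positivity
  have h3 := mul_le_mul_of_nonneg_right h1 (S.integral_nonneg f)
  have h4 := mul_le_mul_of_nonneg_right h2 hN
  refine (S.energy_of_root R hτ hτ' hhi hβ).trans ?_
  linarith

theorem bulk_left (S : FluxSystem K Λ τ β lo hi a b A T ψ Z v u f)
    (hv : v b = 0) (hu : u b = 0) (hdom : Λ ≤ 2 * τ → 4 * K ^ 2 * Λ ^ 2 ≤ lo ^ 2 * τ ^ 2)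
    (hR : 2 * τ ≤ Λ → ∃ p, FluxRoot K Λ a b A Z p)
    (hτ : 8 * K ^ 3 ≤ τ) (hτ' : 4 * K ^ 4 * (4 * hi * K) ^ 2 ≤ τ)
    (hhi : 1 ≤ hi) (hβ : K + 4 * hi * K ^ 2 + 1 ≤ β) :
    Λ ^ 2 / τ * (Λ ^ 2 * (∫ y in a..b, ‖v y‖ ^ 2) + ∫ y in a..b, ‖u y‖ ^ 2) ≤
      bulkConst K hi * ((∫ y in a..b, ‖f y‖ ^ 2) + Λ * (Λ ^ 2 * ‖v a‖ ^ 2 + ‖u a‖ ^ 2)) := by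
  obtain ⟨hC, -, -, -⟩ := le_bulkConst S.one_le_K hhi
  have hΛ : 0 ≤ Λ := by linarith [S.one_le_tau, S.tau_le]
  rcases le_total Λ (2 * τ) with h | h
  · refine (S.bulk_left_of_dominant hv hu (hdom h)).1.trans ?_
    have hF := S.integral_nonneg f
    have hN : 0 ≤ Λ * (Λ ^ 2 * ‖v a‖ ^ 2 + ‖u a‖ ^ 2) := by positivity
    exact (le_add_of_nonneg_right hN).trans (le_mul_of_one_le_left (add_nonneg hF hN) hC)
  · obtain ⟨p, R⟩ := hR h
    simpa [hv, hu] using S.bulk_of_root R hτ hτ' hhi hβ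

theorem bulk_right (S : FluxSystem K Λ τ β lo hi a b A T ψ Z v u f)
    (hv : v a = 0) (hu : u a = 0) (hdom : Λ ≤ 2 * τ → 4 * K ^ 2 * Λ ^ 2 ≤ lo ^ 2 * τ ^ 2)
    (hR : 2 * τ ≤ Λ → ∃ p, FluxRoot K Λ a b A Z p)
    (hτ : 8 * K ^ 3 ≤ τ) (hτ' : 4 * K ^ 4 * (4 * hi * K) ^ 2 ≤ τ)
    (hhi : 1 ≤ hi) (hβ : K + 4 * hi * K ^ 2 + 1 ≤ β) :
    Λ ^ 2 / τ * (Λ ^ 2 * (∫ y in a..b, ‖v y‖ ^ 2) + ∫ y in a..b, ‖u y‖ ^ 2) ≤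
      bulkConst K hi * ((∫ y in a..b, ‖f y‖ ^ 2) + Λ * (Λ ^ 2 * ‖v b‖ ^ 2 + ‖u b‖ ^ 2)) := by
  obtain ⟨hC, hC', -, -⟩ := le_bulkConst S.one_le_K hhi
  have hΛ : 0 ≤ Λ := by linarith [S.one_le_tau, S.tau_le]
  rcases le_total Λ (2 * τ) with h | h
  · refine (S.bulk_right_of_dominant hv hu (hdom h)).trans ?_
    have hF := le_mul_of_one_le_left (S.integral_nonneg f) hC
    have hN : 0 ≤ Λ * (Λ ^ 2 * ‖v b‖ ^ 2 + ‖u b‖ ^ 2) := by positivity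
    rw [mul_add (bulkConst K hi)]
    exact add_le_add hF (mul_le_mul_of_nonneg_right hC' hN)
  · obtain ⟨p, R⟩ := hR h
    simpa [hv, hu] using S.bulk_of_root R hτ hτ' hhi hβ

set_option maxHeartbeats 1000000 in
/-- Two systems coupled at the interface `0`: interior terms are controlled by the data and the
traces, and the traces by the data and the transmission defects. -/
theorem transmission_estimate {ρ lop lom : ℝ} {Ap Am Tp Tm ψp ψm : ℝ → ℝ}
    {Zp Zm vp vm up um fp fm : ℝ → ℂ}
    (Sp : FluxSystem K Λ τ β lop hi 0 ρ Ap Tp ψp Zp vp up fp)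
    (Sm : FluxSystem K Λ τ β lom hi (-ρ) 0 Am Tm ψm Zm vm um fm)
    (hlop : lop = 64 * K ^ 3) (hlom : lom = 4 * K) (hψm : ψm 0 ≤ 16 * K)
    (hRp : 2 * τ ≤ Λ → ∃ p, FluxRoot K Λ 0 ρ Ap Zp p)
    (hRm : 2 * τ ≤ Λ → ∃ p, FluxRoot K Λ (-ρ) 0 Am Zm p)
    (hvp : vp ρ = 0) (hup : up ρ = 0) (hvm : vm (-ρ) = 0) (hum : um (-ρ) = 0)
    (hτ : 8 * K ^ 3 ≤ τ) (hτ' : 4 * K ^ 4 * (4 * hi * K) ^ 2 ≤ τ)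
    (hτ'' : 136 * K ^ 9 * bulkConst K hi ≤ τ) (hhi : 1 ≤ hi)
    (hβ : K + 4 * hi * K ^ 2 + 1 ≤ β) {Fp Fm Jp Jm N E : ℝ}
    (hFp : Fp = ∫ y in (0 : ℝ)..ρ, ‖fp y‖ ^ 2) (hFm : Fm = ∫ y in (-ρ)..0, ‖fm y‖ ^ 2)
    (hJp : Jp = Λ ^ 2 * (∫ y in (0 : ℝ)..ρ, ‖vp y‖ ^ 2) + ∫ y in (0 : ℝ)..ρ, ‖up y‖ ^ 2)
    (hJm : Jm = Λ ^ 2 * (∫ y in (-ρ)..0, ‖vm y‖ ^ 2) + ∫ y in (-ρ)..0, ‖um y‖ ^ 2)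
    (hN : N = (Λ ^ 2 * ‖vp 0‖ ^ 2 + ‖up 0‖ ^ 2) + (Λ ^ 2 * ‖vm 0‖ ^ 2 + ‖um 0‖ ^ 2))
    (hE : E = Λ * (‖up 0 - um 0‖ ^ 2 + Λ ^ 2 * ‖vp 0 - vm 0‖ ^ 2)) :
    Λ ^ 2 / τ * (Jp + Jm) ≤ bulkConst K hi * (Fp + Fm + Λ * N) ∧
      Λ * N ≤ 137 * K ^ 7 * (Fp + Fm + E) := by
  have hK := Sp.one_le_K
  have hτ1 := Sp.one_le_tau
  have hτΛ := Sp.tau_le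
  have hΛ : 0 < Λ := by linarith
  obtain ⟨hC1, hChi, -, -⟩ := le_bulkConst hK hhi
  have hFp0 : 0 ≤ Fp := hFp ▸ Sp.integral_nonneg fp
  have hFm0 : 0 ≤ Fm := hFm ▸ Sm.integral_nonneg fm
  have hIvp := Sp.integral_nonneg vp
  have hIup := Sp.integral_nonneg up
  have hIvm := Sm.integral_nonneg vm
  have hIum := Sm.integral_nonneg um
  have hJp0 : 0 ≤ Jp := by rw [hJp]; positivity
  have hJm0 : 0 ≤ Jm := by rw [hJm]; positivity
  set Np := Λ ^ 2 * ‖vp 0‖ ^ 2 + ‖up 0‖ ^ 2 with hNp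
  set Nm := Λ ^ 2 * ‖vm 0‖ ^ 2 + ‖um 0‖ ^ 2 with hNm
  have hNp0 : 0 ≤ Np := by positivity
  have hNm0 : 0 ≤ Nm := by positivity
  have hE0 : 0 ≤ E := by rw [hE]; positivity
  set Cb := bulkConst K hi
  have bulk_p : Λ ^ 2 / τ * Jp ≤ Cb * (Fp + Λ * Np) := by
    rw [hJp, hFp]
    refine Sp.bulk_left hvp hup (fun h => ?_) hRp hτ hτ' hhi hβ
    rw [hlop]
    calc 4 * K ^ 2 * Λ ^ 2 ≤ 4 * K ^ 2 * (2 * τ) ^ 2 := by gcongr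
      _ = 16 * K ^ 2 * τ ^ 2 := by ring
      _ ≤ 4096 * K ^ 6 * τ ^ 2 := by
        gcongr <;> first | exact hK | norm_num
      _ = _ := by ring
  have bulk_m : Λ ^ 2 / τ * Jm ≤ Cb * (Fm + Λ * Nm) := by
    rw [hJm, hFm]
    refine Sm.bulk_right hvm hum (fun h => ?_) hRm hτ hτ' hhi hβ
    rw [hlom]
    calc 4 * K ^ 2 * Λ ^ 2 ≤ 4 * K ^ 2 * (2 * τ) ^ 2 := by gcongr
      _ = _ := by ring
  have bulk : Λ ^ 2 / τ * (Jp + Jm) ≤ Cb * (Fp + Fm + Λ * N) := by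
    rw [hN]; linarith
  refine ⟨bulk, ?_⟩
  rcases le_total Λ (32 * K ^ 2 * τ) with h | h
  · have hdom : 4 * K ^ 2 * Λ ^ 2 ≤ lop ^ 2 * τ ^ 2 := by
      rw [hlop]
      calc 4 * K ^ 2 * Λ ^ 2 ≤ 4 * K ^ 2 * (32 * K ^ 2 * τ) ^ 2 := by gcongr
        _ = _ := by ring
    have h1 := (Sp.bulk_left_of_dominant hvp hup hdom).2
    rw [← hFp, ← hNp, hlop] at h1
    have h2 : Λ * Np ≤ Fp := by
      have h3 : Λ * Np ≤ 32 * K ^ 2 * τ * Np := by gcongr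
      have h4 : 32 * K ^ 2 * τ * Np ≤ K * (32 * K ^ 2 * τ * Np) :=
        le_mul_of_one_le_left (by positivity) hK
      linarith
    have two : ∀ z w : ℂ, ‖w‖ ^ 2 ≤ 2 * ‖z‖ ^ 2 + 2 * ‖z - w‖ ^ 2 := fun z w => by
      have h3 : ‖w‖ ≤ ‖z‖ + ‖z - w‖ := by
        calc ‖w‖ = ‖z - (z - w)‖ := by rw [sub_sub_cancel]
          _ ≤ _ := norm_sub_le _ _
      have h4 : ‖w‖ ^ 2 ≤ (‖z‖ + ‖z - w‖) ^ 2 := by gcongr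
      linarith [add_sq_le (a := ‖z‖) (b := ‖z - w‖)]
    have h5 : Nm ≤ 2 * Np + 2 * (‖up 0 - um 0‖ ^ 2 + Λ ^ 2 * ‖vp 0 - vm 0‖ ^ 2) := by
      have h6 := mul_le_mul_of_nonneg_left (two (vp 0) (vm 0)) (sq_nonneg Λ)
      have h7 := two (up 0) (um 0)
      rw [hNm, hNp]; linarith
    have h6 := mul_le_mul_of_nonneg_left h5 hΛ.le
    have h7 : Λ * N ≤ 3 * (Fp + Fm + E) := by
      rw [hN, hE]; linarith
    have h8 : (3 : ℝ) ≤ 137 * K ^ 7 := by linarith [one_le_pow₀ hK (n := 7)]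
    exact h7.trans (by gcongr)
  · have h2τ : 2 * τ ≤ Λ := by
      refine le_trans ?_ h
      gcongr
      linarith [one_le_pow₀ hK (n := 2)]
    obtain ⟨p, Rp⟩ := hRp h2τ
    obtain ⟨q, Rm⟩ := hRm h2τ
    have t1 := Sp.trace_left Rp hτ hhi hβ hvp hup
    have hdom : τ * ψm 0 ≤ Λ / (2 * K) := by
      rw [le_div_iff₀ (by positivity)]
      calc τ * ψm 0 * (2 * K) ≤ τ * (16 * K) * (2 * K) := by gcongr
        _ = 32 * K ^ 2 * τ := by ring
        _ ≤ Λ := h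
    have t2 := Sm.trace_right Rm hτ hhi hβ hvm hum hdom
    have t3 := transmission_trace hK hΛ (Rp.norm_le 0) (Rm.norm_le 0) (Rp.le_norm 0)
      (Rm.le_norm 0) (vp := vp 0) (vm := vm 0) (up := up 0) (um := um 0)
    rw [← hNp, ← hNm, ← hN] at t3
    rw [← hFp] at t1
    rw [← hFm] at t2
    set W1 := ‖up 0 + p 0 * vp 0‖ ^ 2
    set W2 := ‖um 0 - q 0 * vm 0‖ ^ 2
    have w1 : Λ * W1 ≤ 2 * K * Fp + 2 * K ^ 3 * Jp := by
      have h1 : Λ / K * W1 ≤ 2 * Fp + 2 * K ^ 2 * Jp := by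
        refine t1.trans ?_
        rw [hJp]
        gcongr
        linarith
      calc Λ * W1 = K * (Λ / K * W1) := by field_simp
        _ ≤ K * (2 * Fp + 2 * K ^ 2 * Jp) := by gcongr
        _ = _ := by ring
    have w2 : Λ * W2 ≤ 4 * K * Fm + 4 * K ^ 3 * Jm := by
      have h1 : Λ / (2 * K) * W2 ≤ 2 * Fm + 2 * K ^ 2 * Jm := by
        refine t2.trans ?_
        rw [hJm]
        gcongr
        linarith
      calc Λ * W2 = 2 * K * (Λ / (2 * K) * W2) := by field_simp
        _ ≤ 2 * K * (2 * Fm + 2 * K ^ 2 * Jm) := by gcongr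
        _ = _ := by ring
    have w3 : Λ * N ≤ 17 * K ^ 6 * (4 * K * (Fp + Fm) + 4 * K ^ 3 * (Jp + Jm) + E) := by
      calc Λ * N ≤ Λ * (17 * K ^ 6 * (W1 + W2 + ‖up 0 - um 0‖ ^ 2 +
            Λ ^ 2 * ‖vp 0 - vm 0‖ ^ 2)) := by gcongr
        _ = 17 * K ^ 6 * (Λ * W1 + Λ * W2 + E) := by rw [hE]; ring
        _ ≤ _ := by
          refine mul_le_mul_of_nonneg_left ?_ (by positivity)
          have : 0 ≤ K * Fp := by positivity
          have : 0 ≤ K ^ 3 * Jp := by positivity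
          linarith
    have hX : 0 ≤ Fp + Fm + Λ * N := by
      rw [hN]; positivity
    have w4 : 17 * K ^ 6 * (4 * K ^ 3 * (Jp + Jm)) ≤ (Fp + Fm + Λ * N) / 2 := by
      have h1 : τ * (Jp + Jm) ≤ Cb * (Fp + Fm + Λ * N) := by
        refine le_trans ?_ bulk
        gcongr
        rw [le_div_iff₀ (by linarith), sq]
        gcongr
      have h2 : 136 * K ^ 9 * (τ * (Jp + Jm)) ≤ τ * (Fp + Fm + Λ * N) := by
        calc 136 * K ^ 9 * (τ * (Jp + Jm)) ≤ 136 * K ^ 9 * (Cb * (Fp + Fm + Λ * N)) := by gcongr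
          _ = 136 * K ^ 9 * Cb * (Fp + Fm + Λ * N) := by ring
          _ ≤ _ := by gcongr
      have h3 : 136 * K ^ 9 * (Jp + Jm) ≤ Fp + Fm + Λ * N := by
        refine le_of_mul_le_mul_left ?_ (by linarith : 0 < τ)
        linarith
      linarith
    have k7 : 1 ≤ K ^ 7 := one_le_pow₀ hK
    have k6 : K ^ 6 ≤ K ^ 7 := pow_le_pow_right₀ hK (by norm_num)
    have hFF : 0 ≤ Fp + Fm := by linarith
    have e1 := mul_le_mul_of_nonneg_right k7 hFF
    have e2 := mul_le_mul_of_nonneg_right k6 hE0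
    have e3 : 0 ≤ K ^ 7 * E := by positivity
    linarith

end FluxSystem

/-- The Carleman estimate across the interface, for coefficients obeying `CoeffBounds` and roots
obeying `RootBounds` in the region `2τ ≤ Λ`. -/
theorem carleman_estimate {K Λ τ s hi β ρ : ℝ}
    {ap am : ℝ → Matrix (Fin (m + 1)) (Fin (m + 1)) ℝ} {ξ γ : Em m} {vp vm : ℝ → ℂ}
    (Hp : CoeffBounds K Λ ap ξ γ τ s) (Hm : CoeffBounds K Λ am ξ γ τ s)
    (hRp : 2 * τ ≤ Λ → ∃ p, RootBounds K Λ ap ξ γ τ s p)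
    (hRm : 2 * τ ≤ Λ → ∃ p, RootBounds K Λ am ξ γ τ s p)
    (hK : 1 ≤ K) (hτ1 : 1 ≤ τ) (hτΛ : τ ≤ Λ) (hs0 : 0 ≤ s) (hs1 : s ≤ 1)
    (hhi : hi = 256 * K ^ 3) (hβ : β = K + 4 * hi * K ^ 2 + 1) (hρ : ρ = β⁻¹)
    (hτ : 8 * K ^ 3 ≤ τ) (hτ' : 4 * K ^ 4 * (4 * hi * K) ^ 2 ≤ τ)
    (hτ'' : 136 * K ^ 9 * bulkConst K hi ≤ τ)
    (hvp : ContDiff ℝ (⊤ : ℕ∞) vp) (hcp : HasCompactSupport vp)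
    (hvm : ContDiff ℝ (⊤ : ℕ∞) vm) (hcm : HasCompactSupport vm)
    (hsp : Function.support vp ⊆ Set.Icc (-ρ) ρ) (hsm : Function.support vm ⊆ Set.Icc (-ρ) ρ) :
    1 / τ * (L2p (deriv (deriv vp)) + L2m (deriv (deriv vm))) +
        Λ ^ 2 / τ * (L2p (deriv vp) + L2m (deriv vm)) + Λ ^ 4 / τ * (L2p vp + L2m vm) +
        Λ * (‖Vval ap ξ γ τ s (128 * K ^ 3) vp‖ ^ 2 + ‖Vval am ξ γ τ s (8 * K) vm‖ ^ 2) +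
        Λ ^ 3 * (‖vp 0‖ ^ 2 + ‖vm 0‖ ^ 2) ≤
      (30 * (hi + β + 2 * K) ^ 6 * (bulkConst K hi + 1) +
          (30 * (hi + β + 2 * K) ^ 6 * bulkConst K hi + 1) * (137 * K ^ 7)) *
        (L2p (Pop ap ξ γ τ s (128 * K ^ 3) β vp) + L2m (Pop am ξ γ τ s (8 * K) β vm) +
          Λ * ‖Vval ap ξ γ τ s (128 * K ^ 3) vp - Vval am ξ γ τ s (8 * K) vm‖ ^ 2 +
          Λ ^ 3 * ‖vp 0 - vm 0‖ ^ 2) := by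
  have k3 : K ≤ K ^ 3 := le_self_pow₀ hK (by norm_num)
  have hhi1 : 1 ≤ hi := by linarith
  have hΛ : 0 < Λ := by linarith
  have hβ1 : K ≤ β := by
    have : 0 ≤ 4 * hi * K ^ 2 := by positivity
    linarith
  have hβ0 : 0 < β := by linarith
  have hρ0 : 0 ≤ ρ := by rw [hρ]; positivity
  have hβρ : β * ρ = 1 := by rw [hρ]; exact mul_inv_cancel₀ hβ0.ne'
  have Sp := Hp.fluxSystem (c := 0) (d := ρ) (α := 128 * K ^ 3) (hi := hi) (β := β) hK hτ1 hτΛ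
    hs0 hs1 (by linarith) (by linarith) hβ1 hρ0 (by linarith) hβρ.le hvp hcp
  have Sm := Hm.fluxSystem (c := -ρ) (d := 0) (α := 8 * K) (hi := hi) (β := β) hK hτ1 hτΛ
    hs0 hs1 (by linarith) (by linarith) hβ1 (by linarith) (by linarith) (by linarith) hvm hcm
  obtain ⟨_, lp⟩ := Hp.exists_bddLip_Pinner (α := 128 * K ^ 3) (β := β) hvp hcp
  obtain ⟨_, lm⟩ := Hm.exists_bddLip_Pinner (α := 8 * K) (β := β) hvm hcm
  have hψ : 8 * K + β * 0 + s * tform am γ 0 ≤ 16 * K := by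
    have h1 := (le_abs_self _).trans (Hm.tform_gamma.1 0)
    have h2 : s * tform am γ 0 ≤ s * K := mul_le_mul_of_nonneg_left h1 hs0
    have h3 : s * K ≤ 1 * K := by gcongr
    linarith
  obtain ⟨hJ, hN⟩ := FluxSystem.transmission_estimate Sp Sm (by ring) (by ring) hψ
    (fun h => (hRp h).imp fun _ R => R.fluxRoot) (fun h => (hRm h).imp fun _ R => R.fluxRoot)
    (eq_zero_of_support_subset_Icc hvp.continuous hsp).2
    (eq_zero_of_support_subset_Icc lp.continuous (support_Pinner_subset hsp)).2
    (eq_zero_of_support_subset_Icc hvm.continuous hsm).1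
    (eq_zero_of_support_subset_Icc lm.continuous (support_Pinner_subset hsm)).1
    hτ hτ' hτ'' hhi1 hβ.ge rfl rfl rfl rfl rfl rfl
  have int : ∀ {w : ℝ → ℂ}, ContDiff ℝ (⊤ : ℕ∞) w → ∀ c d : ℝ,
      IntervalIntegrable (fun y => ‖w y‖ ^ 2) volume c d := fun hw c d =>
    (hw.continuous.norm.pow 2).intervalIntegrable c d
  have rp := Sp.regularity hhi1 Hp.tform_xi.1 (Hp.ae_regular hs0 hs1 hβ0.le)
    (int hvp.deriv_top _ _) (int hvp.deriv_top.deriv_top _ _)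
  have rm := Sm.regularity hhi1 Hm.tform_xi.1 (Hm.ae_regular hs0 hs1 hβ0.le)
    (int hvm.deriv_top _ _) (int hvm.deriv_top.deriv_top _ _)
  have dp := support_deriv_subset_Icc hsp
  have dm := support_deriv_subset_Icc hsm
  rw [L2p_eq_intervalIntegral hρ0 hsp, L2p_eq_intervalIntegral hρ0 dp,
    L2p_eq_intervalIntegral hρ0 (support_deriv_subset_Icc dp),
    L2p_eq_intervalIntegral hρ0 (support_Pop_subset hsp),
    L2m_eq_intervalIntegral hρ0 hsm, L2m_eq_intervalIntegral hρ0 dm,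
    L2m_eq_intervalIntegral hρ0 (support_deriv_subset_Icc dm),
    L2m_eq_intervalIntegral hρ0 (support_Pop_subset hsm)]
  rw [Pinner_zero, Pinner_zero] at hJ hN
  have hFp := Sp.integral_nonneg (Pop ap ξ γ τ s (128 * K ^ 3) β vp)
  have hFm := Sm.integral_nonneg (Pop am ξ γ τ s (8 * K) β vm)
  have hE : 0 ≤ Λ * (‖Vval ap ξ γ τ s (128 * K ^ 3) vp - Vval am ξ γ τ s (8 * K) vm‖ ^ 2 +
      Λ ^ 2 * ‖vp 0 - vm 0‖ ^ 2) := by positivity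
  have hC : 1 ≤ bulkConst K hi := (FluxSystem.le_bulkConst hK hhi1).1
  have hM : 0 ≤ 30 * (hi + β + 2 * K) ^ 6 := by positivity
  generalize 30 * (hi + β + 2 * K) ^ 6 = D at *
  generalize bulkConst K hi = Cb at *
  generalize 137 * K ^ 7 = B at *
  generalize (∫ y in (0 : ℝ)..ρ, ‖Pop ap ξ γ τ s (128 * K ^ 3) β vp y‖ ^ 2) = Fp at *
  generalize (∫ y in (-ρ)..0, ‖Pop am ξ γ τ s (8 * K) β vm y‖ ^ 2) = Fm at *
  have h1 := mul_le_mul_of_nonneg_left hJ hM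
  have h2 := mul_le_mul_of_nonneg_left hN (by positivity : 0 ≤ D * Cb + 1)
  have h3 : 0 ≤ D * (Cb + 1) * (Λ * (‖Vval ap ξ γ τ s (128 * K ^ 3) vp -
      Vval am ξ γ τ s (8 * K) vm‖ ^ 2 + Λ ^ 2 * ‖vp 0 - vm 0‖ ^ 2)) := by positivity
  linarith

/-- **Proposition 3.1.** There exist `τ₀, s₀, ρ, β, C` (and `α₊, α₋` with `L < α₊/α₋`),
depending only on `λ₀, M₀`, such that for `τ ≥ τ₀`, `supp v̂± ⊂ [-ρ, ρ]`, `0 < s ≤ s₀ < 1`,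
the estimate (3.43) holds. -/
theorem statement2 (m : ℕ) (hm : 1 ≤ m) (lam0 M0 lam1 : ℝ)
    (hlam0 : 0 < lam0) (hlam0' : lam0 ≤ 1) (hM0 : 0 < M0)
    (hlam1 : 0 < lam1) (hlam1' : lam1 ≤ lam0) :
    ∃ αp αm β τ0 s0 ρ C : ℝ,
      0 < αp ∧ 0 < αm ∧ 0 < β ∧ 0 < τ0 ∧ 0 < s0 ∧ s0 < 1 ∧ 0 < ρ ∧ 0 < C ∧
      ∀ ap am : ℝ → Matrix (Fin (m + 1)) (Fin (m + 1)) ℝ,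
        GoodCoeff lam0 M0 ap → GoodCoeff lam0 M0 am →
        GoodB lam1 ap → GoodB lam1 am →
        Lconst ap am < αp / αm ∧
        ∀ (γ ξ : Em m), ‖γ‖ ≤ 1 →
        ∀ τ s : ℝ, τ0 ≤ τ → 0 < s → s ≤ s0 →
        ∀ vp vm : ℝ → ℂ,
          ContDiff ℝ (⊤ : ℕ∞) vp → HasCompactSupport vp →
          ContDiff ℝ (⊤ : ℕ∞) vm → HasCompactSupport vm →
          Function.support vp ⊆ Set.Icc (-ρ) ρ →
          Function.support vm ⊆ Set.Icc (-ρ) ρ →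
          (1 / τ) * (L2p (deriv (deriv vp)) + L2m (deriv (deriv vm))) +
            (Lam ξ τ) ^ 2 / τ * (L2p (deriv vp) + L2m (deriv vm)) +
            (Lam ξ τ) ^ 4 / τ * (L2p vp + L2m vm) +
            Lam ξ τ * (‖Vval ap ξ γ τ s αp vp‖ ^ 2 + ‖Vval am ξ γ τ s αm vm‖ ^ 2) +
            (Lam ξ τ) ^ 3 * (‖vp 0‖ ^ 2 + ‖vm 0‖ ^ 2) ≤
          C * (L2p (Pop ap ξ γ τ s αp β vp) + L2m (Pop am ξ γ τ s αm β vm) +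
            Lam ξ τ * ‖Vval ap ξ γ τ s αp vp - Vval am ξ γ τ s αm vm‖ ^ 2 +
            (Lam ξ τ) ^ 3 * ‖vp 0 - vm 0‖ ^ 2) := by
  set K := coeffConst m M0 lam1 with hKdef
  have hlam1'' : lam1 ≤ 1 := hlam1'.trans hlam0'
  have hK : 1 ≤ K := by
    simpa using (coeffConst_bounds (M0 := M0) hm hlam1 hlam1'' rfl).2.2.2 1 0 0 (by norm_num)
      (by norm_num) (by norm_num)
  obtain ⟨hi, hhi⟩ : ∃ hi, hi = 256 * K ^ 3 := ⟨_, rfl⟩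
  obtain ⟨β, hβ⟩ : ∃ β, β = K + 4 * hi * K ^ 2 + 1 := ⟨_, rfl⟩
  have hhi1 : 1 ≤ hi := by linarith [one_le_pow₀ hK (n := 3)]
  have hβ0 : 0 < β := by rw [hβ]; positivity
  have hC : 1 ≤ bulkConst K hi := (FluxSystem.le_bulkConst hK hhi1).1
  have t1 : 0 ≤ 8 * K ^ 3 := by positivity
  have t2 : 0 ≤ 4 * K ^ 4 * (4 * hi * K) ^ 2 := by positivity
  have t3 : 0 ≤ 136 * K ^ 9 * bulkConst K hi := by positivity
  refine ⟨128 * K ^ 3, 8 * K, β,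
    8 * K ^ 3 + 4 * K ^ 4 * (4 * hi * K) ^ 2 + 136 * K ^ 9 * bulkConst K hi + 1, lam1 / 2, β⁻¹, _,
    by positivity, by positivity, hβ0, by positivity, by positivity, by linarith, by positivity,
    ?_, fun ap am hap ham hBp hBm => ⟨?_, fun γ ξ hγ τ s hτ hs hs' vp vm hvp hcp hvm hcm hsp hsm =>
      carleman_estimate (hap.coeffBounds hm hlam0' hlam1 hlam1' hγ ?_ hs.le ?_)
        (ham.coeffBounds hm hlam0' hlam1 hlam1' hγ ?_ hs.le ?_)
        (hap.exists_rootBounds hBp hm hlam0' hlam1 hlam1' hγ ?_ hs.le hs')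
        (ham.exists_rootBounds hBm hm hlam0' hlam1 hlam1' hγ ?_ hs.le hs')
        hK ?_ (le_Lam ξ τ) hs.le ?_ hhi hβ rfl ?_ ?_ ?_ hvp hcp hvm hcm hsp hsm⟩⟩
  · positivity
  · rw [lt_div_iff₀ (by positivity)]
    have h1 := Lconst_le hap ham hBp hBm hm hlam0' hlam1 hlam1'
    calc Lconst ap am * (8 * K) ≤ K * (8 * K) := by gcongr
      _ = 8 * K ^ 2 := by ring
      _ ≤ 8 * K ^ 3 := by gcongr; norm_num
      _ < 128 * K ^ 3 := by linarith [one_le_pow₀ hK (n := 3)]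
  all_goals linarith
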